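/- arXiv:1207.4552 — 3 statements merged into one kernel-verified Lean document; each statement's English description precedes it below -/
import Mathlib

section
/- Let A, C ∈ ℝ be scalars (n = 1) with A < 0, let r ≥ ε ≥ 0 be constants, and assume 2|C|(1 − e^{−|A|ε}) < |A|. Then there exist constants Q, σ > 0 such that for every pair of measurable functions d, q : [0,∞) → [−1,1] and every solution x of system (2.12) with these d, q, the estimate |x(t)| ≤ Q e^{−σt} · max_{−r−ε ≤ s ≤ 0} |x(s)| holds for all t ≥ 0. -/
open MeasureTheory

lemma cmp_aux (a U lam : ℝ) (ha : 0 < a) (hal : 0 < a + lam) (x u : ℝ → ℝ) (hx : Continuous x)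
    (hu : ∀ p q, 0 ≤ p → p ≤ q → IntervalIntegrable u volume p q)
    (heq : ∀ p q, 0 ≤ p → p ≤ q → x q - x p = ∫ τ in p..q, (-a * x τ + u τ))
    (s t : ℝ) (hs : 0 ≤ s) (hst : s ≤ t)
    (hb : ∀ τ ∈ Set.Icc s t, u τ ≤ U * Real.exp (lam * τ)) :
    x t ≤ Real.exp (-a * (t - s)) * x s +
      U / (a + lam) * (Real.exp (lam * t) - Real.exp (-a * (t - s)) * Real.exp (lam * s)) := by
  set φ : ℝ → ℝ := fun t => Real.exp (-a * (t - s)) * x s +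
      U / (a + lam) * (Real.exp (lam * t) - Real.exp (-a * (t - s)) * Real.exp (lam * s)) with hφ
  change x t ≤ φ t
  have hφd : ∀ τ, HasDerivAt φ (-a * φ τ + U * Real.exp (lam * τ)) τ := by
    intro τ
    have h1 : HasDerivAt (fun t => Real.exp (-a * (t - s))) (Real.exp (-a * (τ - s)) * (-a * 1)) τ :=
      (((hasDerivAt_id τ).sub_const s).const_mul (-a)).exp
    have h2 : HasDerivAt (fun t => Real.exp (lam * t)) (Real.exp (lam * τ) * (lam * 1)) τ :=
      ((hasDerivAt_id τ).const_mul lam).exp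
    have h3 := (h1.mul_const (x s)).add
      ((h2.sub (h1.mul_const (Real.exp (lam * s)))).const_mul (U / (a + lam)))
    refine h3.congr_deriv ?_
    simp only [hφ]
    field_simp
    ring
  have hφc : Continuous φ := by simp only [hφ]; fun_prop
  by_contra! hlt
  have hcomp : IsCompact (Set.Icc s t ∩ {τ | x τ ≤ φ τ}) :=
    isCompact_Icc.inter_right (isClosed_le hx hφc)
  have hne : (Set.Icc s t ∩ {τ | x τ ≤ φ τ}).Nonempty :=
    ⟨s, ⟨le_refl _, hst⟩, by simp [hφ]⟩
  obtain ⟨t1, ⟨ht1, ht1'⟩, hmax⟩ := hcomp.exists_isGreatest hne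
  simp only [Set.mem_ofPred_eq] at ht1'
  have hpos : ∀ τ ∈ Set.Ioc t1 t, φ τ < x τ := by
    intro τ hτ
    by_contra! hc
    have := hmax ⟨⟨ht1.1.trans hτ.1.le, hτ.2⟩, hc⟩
    linarith [hτ.1]
  have e1 := heq t1 t (hs.trans ht1.1) ht1.2
  have hi : IntervalIntegrable (fun τ => -a * φ τ + U * Real.exp (lam * τ)) volume t1 t := by
    apply Continuous.intervalIntegrable; fun_prop
  have e2 : ∫ τ in t1..t, (-a * φ τ + U * Real.exp (lam * τ)) = φ t - φ t1 :=
    intervalIntegral.integral_eq_sub_of_hasDerivAt (fun τ _ => hφd τ) hi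
  have hi2 : IntervalIntegrable (fun τ => -a * x τ + u τ) volume t1 t :=
    (Continuous.intervalIntegrable (by fun_prop) _ _).add (hu _ _ (hs.trans ht1.1) ht1.2)
  have := intervalIntegral.integral_mono_on ht1.2 hi2 hi (fun τ hτ => by
    have h1 := hb τ ⟨ht1.1.trans hτ.1, hτ.2⟩
    have h2 : φ τ ≤ x τ := by
      rcases eq_or_lt_of_le hτ.1 with h | h
      · subst h
        by_contra! hc
        have hev : ∀ᶠ y in nhds t1, x y < φ y := (isOpen_lt hx hφc).mem_nhds hc
        have h1t : t1 < t := by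
          rcases eq_or_lt_of_le ht1.2 with h | h
          · subst h; linarith
          · exact h
        have : ∀ᶠ y in nhdsWithin t1 (Set.Ioi t1), x y < φ y ∧ y ∈ Set.Ioc t1 t :=
          (hev.filter_mono nhdsWithin_le_nhds).and (Ioc_mem_nhdsGT h1t)
        obtain ⟨y, hy, hy'⟩ := this.exists
        linarith [hpos y hy']
      · exact (hpos τ ⟨h, hτ.2⟩).le
    nlinarith)
  rw [e2, ← e1] at this
  linarith

lemma cmp_abs (a U lam : ℝ) (ha : 0 < a) (hal : 0 < a + lam) (x u : ℝ → ℝ) (hx : Continuous x)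
    (hu : ∀ p q, 0 ≤ p → p ≤ q → IntervalIntegrable u volume p q)
    (heq : ∀ p q, 0 ≤ p → p ≤ q → x q - x p = ∫ τ in p..q, (-a * x τ + u τ))
    (s t : ℝ) (hs : 0 ≤ s) (hst : s ≤ t)
    (hb : ∀ τ ∈ Set.Icc s t, |u τ| ≤ U * Real.exp (lam * τ)) :
    |x t - Real.exp (-a * (t - s)) * x s| ≤
      U / (a + lam) * (Real.exp (lam * t) - Real.exp (-a * (t - s)) * Real.exp (lam * s)) := by
  have h1 := cmp_aux a U lam ha hal x u hx hu heq s t hs hst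
    (fun τ hτ => (le_abs_self _).trans (hb τ hτ))
  have h2 := cmp_aux a U lam ha hal (fun τ => -x τ) (fun τ => -u τ) hx.neg
    (fun p q h h' => (hu p q h h').neg)
    (fun p q h h' => by
      have := heq p q h h'
      rw [show (∫ τ in p..q, (-a * -x τ + -u τ)) = ∫ τ in p..q, -(-a * x τ + u τ) by
        congr 1; ext τ; ring, intervalIntegral.integral_neg]
      linarith) s t hs hst
    (fun τ hτ => (neg_le_abs _).trans (hb τ hτ))
  rw [abs_le]
  constructor <;> linarith

lemma sup_aux (f : ℝ → ℝ) (T B c k : ℝ) (hT : 0 ≤ T) (hf0 : ∀ s, 0 ≤ f s)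
    (hB : ∀ s ∈ Set.Icc 0 T, f s ≤ B) (hk : k < 1)
    (h : ∀ U, 0 ≤ U → (∀ s ∈ Set.Icc 0 T, f s ≤ U) → ∀ s ∈ Set.Icc 0 T, f s ≤ c + k * U) :
    ∀ s ∈ Set.Icc 0 T, f s ≤ c / (1 - k) := by
  have hbdd : BddAbove (f '' Set.Icc 0 T) := ⟨B, by rintro _ ⟨s, hs, rfl⟩; exact hB s hs⟩
  have hle : ∀ s ∈ Set.Icc 0 T, f s ≤ sSup (f '' Set.Icc 0 T) :=
    fun s hs => le_csSup hbdd ⟨s, hs, rfl⟩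
  have h0 : (0 : ℝ) ∈ Set.Icc 0 T := ⟨le_refl _, hT⟩
  have := h _ ((hf0 0).trans (hle 0 h0)) hle
  have h2 : sSup (f '' Set.Icc 0 T) ≤ c + k * sSup (f '' Set.Icc 0 T) :=
    csSup_le ⟨_, 0, h0, rfl⟩ (by rintro _ ⟨s, hs, rfl⟩; exact this s hs)
  intro s hs
  refine (hle s hs).trans ?_
  rw [le_div_iff₀ (by linarith)]
  linarith

set_option maxHeartbeats 2000000 in
/-- core estimate for continuous `x` -/
lemma core_aux (a C r ε σ M : ℝ) (ha : 0 < a) (hε : 0 ≤ ε) (hεr : ε ≤ r)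
    (hσ0 : 0 < σ) (hσa : σ < a) (k : ℝ)
    (hkdef : k = |C| * (1 - Real.exp (-a * ε)) * Real.exp (σ * (r + ε)) * (1 / (a - σ) + 1 / a))
    (hk : k < 1)
    (x u : ℝ → ℝ) (hx : Continuous x) (hM : ∀ s ∈ Set.Icc (-(r + ε)) 0, |x s| ≤ M)
    (p : ℝ → ℝ) (hp : ∀ t, 0 ≤ t → |p t - (t - r)| ≤ ε)
    (hub : ∀ t, 0 ≤ t → |u t| ≤ |C| * |x (p t) - x (t - r)|)
    (hu : ∀ p q, 0 ≤ p → p ≤ q → IntervalIntegrable u volume p q)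
    (heq : ∀ p q, 0 ≤ p → p ≤ q → x q - x p = ∫ τ in p..q, (-a * x τ + u τ))
    (T : ℝ) (hT : 0 ≤ T) :
    |x T| ≤ (1 + (4 * |C| * Real.exp ((4 * |C| + σ) * (r + ε)) +
        |C| * (1 - Real.exp (-a * ε)) * Real.exp (σ * (r + ε))) / (1 - k) / (a - σ))
      * Real.exp (-σ * T) * M := by
  have hC := abs_nonneg C
  have hM0 : 0 ≤ M := (abs_nonneg _).trans (hM 0 ⟨by linarith, le_refl _⟩)
  have hx0 : |x 0| ≤ M := hM 0 ⟨by linarith, le_refl _⟩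
  -- bound on u
  obtain ⟨B, hB⟩ : ∃ B, ∀ s ∈ Set.Icc (-(r + ε)) T, |x s| ≤ B :=
    (isCompact_Icc).exists_bound_of_continuousOn hx.continuousOn
  have hpm : ∀ t, 0 ≤ t → -(r + ε) ≤ p t ∧ t - (r + ε) ≤ p t ∧ p t ≤ t := by
    intro t ht
    have := abs_le.mp (hp t ht)
    refine ⟨?_, ?_, ?_⟩ <;> linarith [this.1, this.2]
  have habs2 : ∀ α β b : ℝ, |α| ≤ b → |β| ≤ b → |α - β| ≤ 2 * b := by
    intro α β b h1 h2
    have := abs_sub α β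
    linarith
  have huB : ∀ t ∈ Set.Icc 0 T, |u t| ≤ |C| * (2 * B) := by
    intro t ht
    refine (hub t ht.1).trans (mul_le_mul_of_nonneg_left ?_ hC)
    obtain ⟨h1, h2, h3⟩ := hpm t ht.1
    exact habs2 _ _ _ (hB _ ⟨h1, h3.trans ht.2⟩) (hB _ ⟨by linarith [ht.1], by linarith [ht.2]⟩)
  have hB0 : 0 ≤ B := (abs_nonneg _).trans (hB 0 ⟨by linarith, hT⟩)
  -- weighted estimate for x given weighted estimate for u
  have hxw : ∀ lam U, 0 < a + lam → 0 ≤ U →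
      (∀ s ∈ Set.Icc 0 T, |u s| ≤ U * Real.exp (lam * s)) →
      ∀ t ∈ Set.Icc 0 T, |x t| ≤ Real.exp (-a * t) * M + U / (a + lam) * Real.exp (lam * t) := by
    intro lam U hl hU hs t ht
    have h := cmp_abs a U lam ha hl x u hx hu heq 0 t le_rfl ht.1
      (fun τ hτ => hs τ ⟨hτ.1, hτ.2.trans ht.2⟩)
    rw [sub_zero] at h
    have h1 : |x t| ≤ |x t - Real.exp (-a * t) * x 0| + |Real.exp (-a * t) * x 0| := by
      have := abs_add_le (x t - Real.exp (-a * t) * x 0) (Real.exp (-a * t) * x 0)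
      simpa using this
    rw [abs_mul, abs_of_pos (Real.exp_pos _)] at h1
    have h2 := mul_le_mul_of_nonneg_left hx0 (Real.exp_pos (-a * t)).le
    have h3 : 0 ≤ U / (a + lam) * (Real.exp (-a * t) * Real.exp (lam * 0)) := by positivity
    nlinarith
  have hexp1 : ∀ t, 0 ≤ t → Real.exp (-a * t) ≤ 1 := by
    intro t ht
    rw [Real.exp_le_one_iff]; nlinarith
  -- step 1 : exponential growth bound
  have hgrow : ∀ t ∈ Set.Icc 0 T, |u t| * Real.exp (-(4 * |C|) * t) ≤ (2 * |C| * M) / (1 - 1 / 2) := by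
    refine sup_aux _ T (|C| * (2 * B)) _ _ hT (fun s => by positivity) ?_ (by norm_num) ?_
    · intro s hs
      have h1 : Real.exp (-(4 * |C|) * s) ≤ 1 := by
        rw [Real.exp_le_one_iff]; nlinarith [hs.1]
      calc _ ≤ |u s| * 1 := mul_le_mul_of_nonneg_left h1 (abs_nonneg _)
        _ ≤ _ := by rw [mul_one]; exact huB s hs
    · intro U hU hUs t ht
      have hus : ∀ s ∈ Set.Icc 0 T, |u s| ≤ U * Real.exp ((4 * |C|) * s) := by
        intro s hs
        have := hUs s hs
        rw [neg_mul, Real.exp_neg, ← div_eq_mul_inv, div_le_iff₀ (Real.exp_pos _)] at this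
        exact this
      have hw := hxw (4 * |C|) U (by positivity) hU hus
      have hall : ∀ y, -(r + ε) ≤ y → y ≤ t →
          |x y| ≤ M + U / (a + 4 * |C|) * Real.exp (4 * |C| * t) := by
        intro y hy1 hy2
        have hq : 0 ≤ U / (a + 4 * |C|) := by positivity
        rcases le_total y 0 with h | h
        · have := hM y ⟨hy1, h⟩
          have : 0 ≤ U / (a + 4 * |C|) * Real.exp (4 * |C| * t) := by positivity
          linarith
        · have h1 := hw y ⟨h, hy2.trans ht.2⟩
          have h2 : Real.exp (4 * |C| * y) ≤ Real.exp (4 * |C| * t) := by gcongr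
          have h3 := mul_le_mul_of_nonneg_left h2 hq
          have h4 := mul_le_mul_of_nonneg_right (hexp1 y h) hM0
          linarith
      obtain ⟨h1, h2, h3⟩ := hpm t ht.1
      have hu1 := (hub t ht.1).trans (mul_le_mul_of_nonneg_left
        (habs2 _ _ _ (hall _ h1 h3) (hall (t - r) (by linarith [ht.1]) (by linarith))) hC)
      have he : Real.exp (-(4 * |C|) * t) ≤ 1 := by
        rw [Real.exp_le_one_iff]; nlinarith [ht.1]
      have hee : Real.exp (4 * |C| * t) * Real.exp (-(4 * |C|) * t) = 1 := by
        rw [← Real.exp_add]; simp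
      have h5 := mul_le_mul_of_nonneg_right hu1 (Real.exp_pos (-(4 * |C|) * t)).le
      have h6 : 2 * |C| * (U / (a + 4 * |C|)) ≤ 1 / 2 * U := by
        rw [← mul_div_assoc, div_le_iff₀ (by positivity)]
        nlinarith [mul_nonneg ha.le hU]
      have h7 : |C| * (2 * (M + U / (a + 4 * |C|) * Real.exp (4 * |C| * t))) * Real.exp (-(4 * |C|) * t)
        = 2 * |C| * M * Real.exp (-(4 * |C|) * t) + 2 * |C| * (U / (a + 4 * |C|)) *
          (Real.exp (4 * |C| * t) * Real.exp (-(4 * |C|) * t)) := by ring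
      rw [h7, hee] at h5
      have h8 : 2 * |C| * M * Real.exp (-(4 * |C|) * t) ≤ 2 * |C| * M * 1 :=
        mul_le_mul_of_nonneg_left he (by positivity)
      linarith
  -- step 2 : decay
  set g := 1 - Real.exp (-a * ε) with hg
  have hg0 : 0 ≤ g := by have := hexp1 ε hε; linarith
  set E := Real.exp (σ * (r + ε)) with hE
  have hE0 : 0 < E := Real.exp_pos _
  set K1 := 4 * |C| * Real.exp ((4 * |C| + σ) * (r + ε)) with hK1
  have hK10 : 0 ≤ K1 := by positivity
  have haσ : 0 < a - σ := by linarith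
  have hk0 : 0 ≤ k := by rw [hkdef]; positivity
  have hdec : ∀ t ∈ Set.Icc 0 T, |u t| * Real.exp (σ * t) ≤ ((K1 + |C| * g * E) * M) / (1 - k) := by
    refine sup_aux _ T (|C| * (2 * B) * Real.exp (σ * T)) _ _ hT (fun s => by positivity) ?_ hk ?_
    · intro s hs
      have h1 : Real.exp (σ * s) ≤ Real.exp (σ * T) := by
        have := hs.2
        gcongr
      exact mul_le_mul (huB s hs) h1 (Real.exp_pos _).le (by positivity)
    · intro U hU hUs t ht
      have hus : ∀ s ∈ Set.Icc 0 T, |u s| ≤ U * Real.exp (-σ * s) := by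
        intro s hs
        have := hUs s hs
        rw [← le_div_iff₀ (Real.exp_pos _)] at this
        rwa [neg_mul, Real.exp_neg, ← div_eq_mul_inv]
      have hw := hxw (-σ) U (by linarith) hU hus
      have hw' : ∀ y ∈ Set.Icc 0 T, |x y| ≤ (M + U / (a - σ)) * Real.exp (-σ * y) := by
        intro y hy
        have h1 := hw y hy
        have h2 : Real.exp (-a * y) ≤ Real.exp (-σ * y) := by
          apply Real.exp_le_exp.mpr; nlinarith [hy.1]
        have h3 := mul_le_mul_of_nonneg_right h2 hM0
        rw [← sub_eq_add_neg] at h1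
        linarith
      rcases lt_or_ge t (r + ε) with hlt | hge
      · have h1 := hgrow t ht
        rw [neg_mul, Real.exp_neg, ← div_eq_mul_inv, div_le_iff₀ (Real.exp_pos _)] at h1
        have h2 : Real.exp (4 * |C| * t) * Real.exp (σ * t) ≤ Real.exp ((4 * |C| + σ) * (r + ε)) := by
          rw [← Real.exp_add, ← add_mul]
          gcongr
        have h3 := mul_le_mul_of_nonneg_right h1 (Real.exp_pos (σ * t)).le
        have h4 := mul_le_mul_of_nonneg_left h2 (show 0 ≤ 4 * |C| * M by positivity)
        have h5 : 0 ≤ |C| * g * E * M := by positivity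
        have h6 : 0 ≤ k * U := by positivity
        have h7 : K1 * M = 4 * |C| * M * Real.exp ((4 * |C| + σ) * (r + ε)) := by rw [hK1]; ring
        have h8 : 2 * |C| * M / (1 - 1 / 2) * Real.exp (4 * |C| * t) * Real.exp (σ * t)
          = 4 * |C| * M * (Real.exp (4 * |C| * t) * Real.exp (σ * t)) := by ring
        rw [h8] at h3
        have h9 : (K1 + |C| * g * E) * M = K1 * M + |C| * g * E * M := by ring
        rw [h9, h7]
        linarith
      · have hdiff : ∀ s s', t - (r + ε) ≤ s → s ≤ s' → s' ≤ t → s' - s ≤ ε →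
            |x s' - x s| ≤ g * (M + U * (1 / (a - σ) + 1 / a)) * (E * Real.exp (-σ * t)) := by
          intro s s' h1 h2 h3 h4
          have hs0 : 0 ≤ s := by linarith
          have hc := cmp_abs a (U * Real.exp (-σ * s)) 0 ha (by linarith) x u hx hu heq s s' hs0 h2
            (fun τ hτ => by
              have := hus τ ⟨hs0.trans hτ.1, hτ.2.trans (h3.trans ht.2)⟩
              have h5 : Real.exp (-σ * τ) ≤ Real.exp (-σ * s) := by
                apply Real.exp_le_exp.mpr; nlinarith [hτ.1]
              have := mul_le_mul_of_nonneg_left h5 hU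
              simp only [zero_mul, Real.exp_zero, mul_one]
              linarith)
          simp only [zero_mul, Real.exp_zero, mul_one, add_zero] at hc
          have hxs := hw' s ⟨hs0, by linarith [ht.2]⟩
          have hg1 : 1 - Real.exp (-a * (s' - s)) ≤ g := by
            have : Real.exp (-a * ε) ≤ Real.exp (-a * (s' - s)) := by
              apply Real.exp_le_exp.mpr; nlinarith
            linarith
          have hg2 : 0 ≤ 1 - Real.exp (-a * (s' - s)) := by
            linarith [hexp1 (s' - s) (by linarith)]
          have hes : Real.exp (-σ * s) ≤ E * Real.exp (-σ * t) := by
            rw [hE, ← Real.exp_add]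
            apply Real.exp_le_exp.mpr; nlinarith
          have htri : |x s' - x s| ≤ |x s' - Real.exp (-a * (s' - s)) * x s| +
              (1 - Real.exp (-a * (s' - s))) * |x s| := by
            have := abs_sub (x s' - Real.exp (-a * (s' - s)) * x s)
              ((1 - Real.exp (-a * (s' - s))) * x s)
            rw [abs_mul (1 - _), abs_of_nonneg hg2] at this
            have e : x s' - Real.exp (-a * (s' - s)) * x s - (1 - Real.exp (-a * (s' - s))) * x s
              = x s' - x s := by ring
            rw [e] at this
            exact this
          have hX : 0 ≤ M + U * (1 / (a - σ) + 1 / a) := by positivity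
          calc |x s' - x s| ≤ U * Real.exp (-σ * s) / a * (1 - Real.exp (-a * (s' - s))) +
                (1 - Real.exp (-a * (s' - s))) * ((M + U / (a - σ)) * Real.exp (-σ * s)) := by
                have := mul_le_mul_of_nonneg_left hxs hg2
                linarith
            _ = (1 - Real.exp (-a * (s' - s))) * (M + U * (1 / (a - σ) + 1 / a)) *
                Real.exp (-σ * s) := by ring
            _ ≤ _ := by gcongr
        have hd : |x (p t) - x (t - r)| ≤
            g * (M + U * (1 / (a - σ) + 1 / a)) * (E * Real.exp (-σ * t)) := by
          obtain ⟨h1, h2, h3⟩ := hpm t ht.1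
          have h4 := abs_le.mp (hp t ht.1)
          rcases le_total (p t) (t - r) with h | h
          · rw [abs_sub_comm]
            exact hdiff _ _ h2 h (by linarith) (by linarith [h4.1])
          · exact hdiff _ _ (by linarith) h h3 (by linarith [h4.2])
        have h5 := (hub t ht.1).trans (mul_le_mul_of_nonneg_left hd hC)
        have h6 := mul_le_mul_of_nonneg_right h5 (Real.exp_pos (σ * t)).le
        have hee : Real.exp (-σ * t) * Real.exp (σ * t) = 1 := by
          rw [← Real.exp_add]; simp
        have h7 : |C| * (g * (M + U * (1 / (a - σ) + 1 / a)) * (E * Real.exp (-σ * t))) *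
            Real.exp (σ * t) = |C| * g * E * M * (Real.exp (-σ * t) * Real.exp (σ * t))
            + |C| * g * E * (1 / (a - σ) + 1 / a) * U * (Real.exp (-σ * t) * Real.exp (σ * t)) := by
          ring
        rw [h7, hee, ← hkdef] at h6
        have : 0 ≤ K1 * M := by positivity
        linarith
  have hk1 : 0 < 1 - k := by linarith
  have hfin := hxw (-σ) (((K1 + |C| * g * E) * M) / (1 - k)) (by linarith) (by positivity)
    (fun s hs => by
      have := hdec s hs
      rw [← le_div_iff₀ (Real.exp_pos _)] at this
      rwa [neg_mul, Real.exp_neg, ← div_eq_mul_inv]) T ⟨hT, le_rfl⟩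
  have h2 : Real.exp (-a * T) ≤ Real.exp (-σ * T) := by
    apply Real.exp_le_exp.mpr; nlinarith
  have h3 := mul_le_mul_of_nonneg_right h2 hM0
  rw [← sub_eq_add_neg] at hfin
  refine hfin.trans ?_
  have h4 : (1 + (K1 + |C| * g * E) / (1 - k) / (a - σ)) * Real.exp (-σ * T) * M
    = Real.exp (-σ * T) * M + (K1 + |C| * g * E) * M / (1 - k) / (a - σ) * Real.exp (-σ * T) := by
    ring
  rw [h4]
  linarith

theorem stmt_1 (A C : ℝ) (hA : A < 0) (r ε : ℝ) (hε : 0 ≤ ε) (hεr : ε ≤ r)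
    (hsg : 2 * |C| * (1 - Real.exp (-|A| * ε)) < |A|) :
    ∃ Q σ : ℝ, 0 < Q ∧ 0 < σ ∧
      ∀ (d q : ℝ → ℝ), Measurable d → (∀ t, 0 ≤ t → d t ∈ Set.Icc (-1 : ℝ) 1) →
        Measurable q → (∀ t, 0 ≤ t → q t ∈ Set.Icc (-1 : ℝ) 1) →
        ∀ x : ℝ → ℝ,
          ContinuousOn x (Set.Ici (-(r + ε))) →
          (∀ t : ℝ, 0 ≤ t →
            x t = x 0 + ∫ s in (0 : ℝ)..t,
              (A * x s + q s * C * (x (s - r - ε * d s) - x (s - r)))) →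
          ∀ t : ℝ, 0 ≤ t →
            |x t| ≤ Q * Real.exp (-σ * t) *
              sSup ((fun s => |x s|) '' Set.Icc (-(r + ε)) 0) := by
  obtain ⟨a, rfl⟩ : ∃ a, A = -a := ⟨-A, by ring⟩
  have ha : 0 < a := by linarith
  rw [abs_neg, abs_of_pos ha] at hsg
  have hev : ∀ᶠ σ in nhdsWithin (0 : ℝ) (Set.Ioi 0), (|C| * (1 - Real.exp (-a * ε)) *
      Real.exp (σ * (r + ε)) * (1 / (a - σ) + 1 / a) < 1 ∧ σ < a) ∧ σ ∈ Set.Ioi (0 : ℝ) := by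
    refine Filter.Eventually.and (Filter.Eventually.filter_mono nhdsWithin_le_nhds ?_)
      self_mem_nhdsWithin
    refine Filter.Eventually.and ?_ (gt_mem_nhds ha)
    have hc : ContinuousAt (fun σ : ℝ => |C| * (1 - Real.exp (-a * ε)) *
      Real.exp (σ * (r + ε)) * (1 / (a - σ) + 1 / a)) 0 := by
      have : a - 0 ≠ 0 := by linarith
      fun_prop (disch := assumption)
    apply hc.eventually_lt_const
    simp only [zero_mul, Real.exp_zero, sub_zero, mul_one]
    rw [← add_div, mul_div_assoc', div_lt_one ha]
    linarith
  obtain ⟨σ, ⟨hk, hσa⟩, hσ0⟩ := hev.exists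
  have hσ0 : 0 < σ := hσ0
  have hg0 : 0 ≤ 1 - Real.exp (-a * ε) := by
    have : Real.exp (-a * ε) ≤ 1 := by rw [Real.exp_le_one_iff]; nlinarith
    linarith
  have haσ : 0 < a - σ := by linarith
  have hk1 := sub_pos.mpr hk
  refine ⟨(1 + (4 * |C| * Real.exp ((4 * |C| + σ) * (r + ε)) +
        |C| * (1 - Real.exp (-a * ε)) * Real.exp (σ * (r + ε))) / (1 - (|C| * (1 - Real.exp (-a * ε)) *
      Real.exp (σ * (r + ε)) * (1 / (a - σ) + 1 / a))) / (a - σ)), σ, ?_, hσ0, fun d q hd hd1 hq hq1 x hx hxe t ht =>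
    ?_⟩
  · positivity
  set R := r + ε with hR
  have hR0 : 0 ≤ R := by linarith
  set y : ℝ → ℝ := fun s => x (max s (-R)) with hy
  have hyx : ∀ s, -R ≤ s → y s = x s := fun s hs => by simp [hy, max_eq_left hs]
  have hyc : Continuous y := hx.comp_continuous (by fun_prop) (fun s => Set.mem_Ici.mpr (le_max_right _ _))
  set u : ℝ → ℝ := fun s => q s * C * (y (s - r - ε * d s) - y (s - r)) with hu
  have hum : Measurable u := by
    have h1 := hyc.measurable
    simp only [hu]
    fun_prop
  have hdε : ∀ s, 0 ≤ s → |ε * d s| ≤ ε := by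
    intro s hs
    rw [abs_mul, abs_of_nonneg hε]
    have := abs_le.mpr (hd1 s hs)
    nlinarith
  have hub : ∀ s, 0 ≤ s → |u s| ≤ |C| * |y (s - r - ε * d s) - y (s - r)| := by
    intro s hs
    simp only [hu, abs_mul]
    have := abs_le.mpr (hq1 s hs)
    have h2 : |q s| * |C| ≤ |C| := by nlinarith [abs_nonneg C]
    exact mul_le_mul_of_nonneg_right h2 (abs_nonneg _)
  have hui : ∀ p q, 0 ≤ p → p ≤ q → IntervalIntegrable u volume p q := by
    intro p q hp hpq
    obtain ⟨B, hB⟩ : ∃ B, ∀ s ∈ Set.Icc (-R) q, |y s| ≤ B :=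
      (isCompact_Icc).exists_bound_of_continuousOn hyc.continuousOn
    have hi : IntervalIntegrable (fun _ : ℝ => |C| * (2 * B)) volume p q :=
      intervalIntegrable_const
    refine hi.mono_fun' hum.aestronglyMeasurable ?_
    refine (ae_restrict_iff' measurableSet_uIoc).mpr (Filter.Eventually.of_forall fun s hs => ?_)
    rw [Set.uIoc_of_le hpq] at hs
    have hs0 : 0 ≤ s := by linarith [hs.1]
    refine (hub s hs0).trans (mul_le_mul_of_nonneg_left ?_ (abs_nonneg _))
    have h1 := abs_le.mp (hdε s hs0)
    have h2 := hB (s - r - ε * d s) ⟨by linarith [h1.2], by linarith [h1.1, hs.2]⟩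
    have h3 := hB (s - r) ⟨by linarith, by linarith [hs.2]⟩
    have := abs_sub (y (s - r - ε * d s)) (y (s - r))
    linarith
  have hye : ∀ t, 0 ≤ t → y t = y 0 + ∫ s in (0 : ℝ)..t, (-a * y s + u s) := by
    intro t ht
    rw [hyx t (by linarith), hyx 0 (by linarith), hxe t ht]
    congr 1
    apply intervalIntegral.integral_congr
    intro s hs
    rw [Set.uIcc_of_le ht] at hs
    have h1 := abs_le.mp (hdε s hs.1)
    simp only [hu]
    rw [hyx s (by linarith [hs.1]), hyx (s - r) (by linarith [hs.1]),
      hyx (s - r - ε * d s) (by linarith [hs.1, h1.2])]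
  have hii : ∀ p q, 0 ≤ p → p ≤ q →
      IntervalIntegrable (fun s => -a * y s + u s) volume p q := fun p q hp hpq =>
    (Continuous.intervalIntegrable (by fun_prop) _ _).add (hui p q hp hpq)
  have heq : ∀ p q, 0 ≤ p → p ≤ q → y q - y p = ∫ τ in p..q, (-a * y τ + u τ) := by
    intro p q hp hpq
    have := intervalIntegral.integral_add_adjacent_intervals (hii 0 p le_rfl hp) (hii p q hp hpq)
    rw [hye q (hp.trans hpq), hye p hp]
    linarith
  have hbdd : BddAbove ((fun s => |x s|) '' Set.Icc (-R) 0) :=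
    (isCompact_Icc.image_of_continuousOn
      ((hx.mono Set.Icc_subset_Ici_self).abs)).bddAbove
  have hfin := core_aux a C r ε σ (sSup ((fun s => |x s|) '' Set.Icc (-R) 0)) ha hε hεr hσ0 hσa _ rfl hk
    y u hyc (fun s hs => by rw [hyx s hs.1]; exact le_csSup hbdd ⟨s, hs, rfl⟩)
    (fun s => s - r - ε * d s) (fun s hs => by
      have := hdε s hs
      rw [← abs_neg] at this
      convert this using 2
      ring) hub hui heq t ht
  rw [hyx t (by linarith)] at hfin
  exact hfin
end

section
/- Let n = 1, let 0 < ε ≤ r be constants, A, B ∈ ℝ, k ∈ ℝ with A + Bk < 0, and assume 2|Bk| e^{Ar} (1 − e^{−|A+Bk|ε}) < |A+Bk|. Then there exist constants Q, σ > 0 such that for every measurable d : [0,∞) → [−1,1], every x₀ ∈ ℝ and every continuous u₀ : [−r−ε,0] → ℝ with u₀(0) = k e^{Ar} x₀ + k ∫_{−r}^{0} e^{−As} B u₀(s) ds, the solution (x, u) of the closed-loop system with initial conditions x(0) = x₀ and u(t) = u₀(t) for t ∈ [−r−ε,0] satisfies |x(t)| + max_{t−ε−r ≤ s ≤ t} |u(s)|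 ≤ Q e^{−σt} (|x₀| + max_{−ε−r ≤ s ≤ 0} |u₀(s)|) for all t ≥ 0. -/
open MeasureTheory

lemma voc {a : ℝ} {y f g : ℝ → ℝ} (hg : ∀ p q, IntervalIntegrable g volume p q)
    (hy : ∀ t, 0 ≤ t → y t = y 0 + ∫ s in (0:ℝ)..t, g s)
    (hgf : ∀ s, 0 ≤ s → g s = -a * y s + f s) {t1 t2 : ℝ} (h1 : 0 ≤ t1) (h12 : t1 ≤ t2) :
    y t2 = Real.exp (-a * (t2 - t1)) * y t1 + ∫ s in t1..t2, Real.exp (-a * (t2 - s)) * f s := by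
  have h2 : 0 ≤ t2 := h1.trans h12
  have hsub : Set.uIcc t1 t2 ⊆ Set.uIcc 0 t2 := by
    rw [Set.uIcc_of_le h12, Set.uIcc_of_le h2]
    exact Set.Icc_subset_Icc_left h1
  have hY : AbsolutelyContinuousOnInterval (fun t => y 0 + ∫ s in (0:ℝ)..t, g s) t1 t2 := by
    have hc : AbsolutelyContinuousOnInterval (fun _ : ℝ => y 0) t1 t2 :=
      (contDiff_const.contDiffOn).absolutelyContinuousOnInterval
    exact hc.fun_add (((hg 0 t2).absolutelyContinuousOnInterval_intervalIntegral
      (c := 0) (by simp)).mono hsub)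
  have hE : AbsolutelyContinuousOnInterval (fun t => Real.exp (-a * (t2 - t))) t1 t2 := by
    refine ContDiffOn.absolutelyContinuousOnInterval (ContDiff.contDiffOn ?_)
    fun_prop
  have key := hE.integral_deriv_mul_eq_sub hY
  have hcong : ∫ x in t1..t2, deriv (fun t => Real.exp (-a * (t2 - t))) x *
        (y 0 + ∫ s in (0:ℝ)..x, g s) +
        Real.exp (-a * (t2 - x)) * deriv (fun t => y 0 + ∫ s in (0:ℝ)..t, g s) x
      = ∫ s in t1..t2, Real.exp (-a * (t2 - s)) * f s := by
    apply intervalIntegral.integral_congr_ae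
    filter_upwards [(hg 0 t2).ae_hasDerivAt_integral] with x hx hxm
    have hxm' : x ∈ Set.uIcc t1 t2 := Set.uIoc_subset_uIcc hxm
    have hd := (hx (hsub hxm') 0 (by simp)).const_add (y 0)
    rw [hd.deriv]
    have hx0 : 0 ≤ x := by
      rw [Set.uIcc_of_le h12] at hxm'
      exact h1.trans hxm'.1
    have hd2 : HasDerivAt (fun t => Real.exp (-a * (t2 - t))) (Real.exp (-a * (t2 - x)) * a) x := by
      have := (((hasDerivAt_id x).const_sub t2).const_mul (-a)).exp
      simpa using this
    rw [hd2.deriv, ← hy x hx0, hgf x hx0]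
    ring
  rw [hcong, ← hy t1 h1, ← hy t2 h2] at key
  simp at key
  simp
  linarith

lemma conv1 {a D t1 t2 : ℝ} {f : ℝ → ℝ} (ha : 0 < a) (h12 : t1 ≤ t2)
    (hf : ∀ s ∈ Set.Icc t1 t2, |f s| ≤ D) :
    |∫ s in t1..t2, Real.exp (-a * (t2 - s)) * f s| ≤ D * (1 - Real.exp (-a * (t2 - t1))) / a := by
  have hint : ∫ s in t1..t2, Real.exp (-a * (t2 - s)) * D
      = D * (1 - Real.exp (-a * (t2 - t1))) / a := by
    rw [intervalIntegral.integral_eq_sub_of_hasDerivAt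
      (f := fun s => D / a * Real.exp (-a * (t2 - s)))]
    · simp; ring
    · intro x _
      have := ((((hasDerivAt_id x).const_sub t2).const_mul (-a)).exp).const_mul (D / a)
      convert! this using 1
      simp; field_simp
    · exact Continuous.intervalIntegrable (by fun_prop) _ _
  rw [← hint, ← Real.norm_eq_abs]
  refine intervalIntegral.norm_integral_le_of_norm_le h12 ?_
    (Continuous.intervalIntegrable (by fun_prop) _ _)
  refine Filter.Eventually.of_forall fun s hs => ?_
  rw [Real.norm_eq_abs, abs_mul, Real.abs_exp]
  exact mul_le_mul_of_nonneg_left (hf s (Set.Ioc_subset_Icc_self hs)) (Real.exp_pos _).le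

lemma conv2 {a σ D t1 t2 : ℝ} {f : ℝ → ℝ} (ha : σ < a) (hD : 0 ≤ D) (h12 : t1 ≤ t2)
    (hf : ∀ s ∈ Set.Icc t1 t2, |f s| ≤ D * Real.exp (-σ * s)) :
    |∫ s in t1..t2, Real.exp (-a * (t2 - s)) * f s| ≤ D * Real.exp (-σ * t2) / (a - σ) := by
  have hpos : 0 < a - σ := by linarith
  have hint : ∫ s in t1..t2, Real.exp (-a * (t2 - s)) * (D * Real.exp (-σ * s))
      = D / (a - σ) * Real.exp (-σ * t2) - D / (a - σ) * Real.exp (-a * (t2 - t1) + -σ * t1) := by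
    rw [intervalIntegral.integral_eq_sub_of_hasDerivAt
      (f := fun s => D / (a - σ) * Real.exp (-a * (t2 - s) + -σ * s))]
    · simp
    · intro x _
      have := (((((hasDerivAt_id x).const_sub t2).const_mul (-a)).add
        ((hasDerivAt_id x).const_mul (-σ))).exp).const_mul (D / (a - σ))
      convert! this using 1
      simp [Real.exp_add]; field_simp; ring
    · exact Continuous.intervalIntegrable (by fun_prop) _ _
  have hle : ∫ s in t1..t2, Real.exp (-a * (t2 - s)) * (D * Real.exp (-σ * s))
      ≤ D * Real.exp (-σ * t2) / (a - σ) := by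
    rw [hint]
    have : 0 ≤ D / (a - σ) * Real.exp (-a * (t2 - t1) + -σ * t1) := by positivity
    have e : D * Real.exp (-σ * t2) / (a - σ) = D / (a - σ) * Real.exp (-σ * t2) := by ring
    linarith
  refine le_trans ?_ hle
  rw [← Real.norm_eq_abs]
  refine intervalIntegral.norm_integral_le_of_norm_le h12 ?_
    (Continuous.intervalIntegrable (by fun_prop) _ _)
  refine Filter.Eventually.of_forall fun s hs => ?_
  rw [Real.norm_eq_abs, abs_mul, Real.abs_exp]
  exact mul_le_mul_of_nonneg_left (hf s (Set.Ioc_subset_Icc_self hs)) (Real.exp_pos _).le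

lemma boot {S : Set ℝ} {F : ℝ → ℝ} {b c γ : ℝ} (hγ : γ < 1) (h0 : ∀ t ∈ S, 0 ≤ F t)
    (hb : ∀ t ∈ S, F t ≤ b)
    (h : ∀ N, 0 ≤ N → (∀ t ∈ S, F t ≤ N) → ∀ t ∈ S, F t ≤ c + γ * N) :
    ∀ t ∈ S, F t ≤ c / (1 - γ) := by
  intro t ht
  have hbdd : BddAbove (F '' S) := ⟨b, by rintro _ ⟨s, hs, rfl⟩; exact hb s hs⟩
  have hle : ∀ s ∈ S, F s ≤ sSup (F '' S) := fun s hs => le_csSup hbdd ⟨s, hs, rfl⟩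
  have hN : 0 ≤ sSup (F '' S) := (h0 t ht).trans (hle t ht)
  have h1 : sSup (F '' S) ≤ c + γ * sSup (F '' S) := by
    refine csSup_le ⟨_, t, ht, rfl⟩ ?_
    rintro _ ⟨s, hs, rfl⟩
    exact h _ hN hle s hs
  refine (hle t ht).trans ?_
  rw [le_div_iff₀ (by linarith)]
  linarith

set_option maxHeartbeats 4000000 in
lemma core {a c r ε : ℝ} (ha : 0 < a) (hc : 0 ≤ c) (hε : 0 < ε) (hεr : ε ≤ r)
    (hsg : 2 * c * (1 - Real.exp (-a * ε)) < a) :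
    ∃ C σ : ℝ, 0 < C ∧ 0 < σ ∧ σ < a ∧ ∀ (u w f : ℝ → ℝ) (U : ℝ), Continuous u → 0 ≤ U →
      (∀ t ∈ Set.Icc (-(r + ε)) 0, |u t| ≤ U) →
      (∀ t, 0 ≤ t → ∃ τ ∈ Set.Icc (-ε) ε, w t = u (t - r + τ) - u (t - r)) →
      (∀ t, 0 ≤ t → |f t| ≤ c * |w t|) →
      (∀ t1 t2, 0 ≤ t1 → t1 ≤ t2 → u t2 = Real.exp (-a * (t2 - t1)) * u t1 +
        ∫ s in t1..t2, Real.exp (-a * (t2 - s)) * f s) →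
      ∀ t, 0 ≤ t → |w t| ≤ C * U * Real.exp (-σ * t) := by
  set g := 1 - Real.exp (-a * ε) with hg
  have hg0 : 0 ≤ g := by
    have : Real.exp (-a * ε) ≤ 1 := Real.exp_le_one_iff.2 (by nlinarith)
    linarith
  -- choice of σ
  obtain ⟨σ, hσ0, hσa, hσγ⟩ : ∃ σ : ℝ, 0 < σ ∧ σ < a ∧
      Real.exp (σ * (r + ε)) * g * c * (1 / (a - σ) + 1 / a) < 1 := by
    have hcont : ContinuousAt
        (fun σ : ℝ => Real.exp (σ * (r + ε)) * g * c * (1 / (a - σ) + 1 / a)) 0 := by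
      have : a - 0 ≠ 0 := by simpa using ha.ne'
      fun_prop (disch := assumption)
    have h0 : Real.exp ((0:ℝ) * (r + ε)) * g * c * (1 / (a - 0) + 1 / a) < 1 := by
      have : Real.exp ((0:ℝ) * (r + ε)) * g * c * (1 / (a - 0) + 1 / a) = 2 * c * g / a := by
        simp; ring
      rw [this, div_lt_one ha]; exact hsg
    have e1 := hcont.eventually_lt (continuousAt_const (y := (1:ℝ))) h0
    have e2 : ∀ᶠ σ : ℝ in nhds 0, σ < a := eventually_lt_nhds ha
    have e3 := (e1.and e2).filter_mono (nhdsWithin_le_nhds (s := Set.Ioi (0:ℝ)))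
    obtain ⟨σ, ⟨h1, h2⟩, h3⟩ := (e3.and self_mem_nhdsWithin).exists
    exact ⟨σ, h3, h2, h1⟩
  set γ := Real.exp (σ * (r + ε)) * g * c * (1 / (a - σ) + 1 / a) with hγ
  set L := Real.exp (σ * (r + ε)) with hL
  set E := Real.exp (4 * c * (r + ε)) with hE
  have hL0 : 0 < L := Real.exp_pos _
  have hT0 : 0 < r + ε := by linarith
  have hE1 : 1 ≤ E := Real.one_le_exp (by positivity)
  have haσ : 0 < a - σ := by linarith
  have h1γ : 0 < 1 - γ := by linarith
  refine ⟨(6 * E * L + L * g) / (1 - γ), σ, by positivity, hσ0, hσa, ?_⟩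
  intro u w f U hu hU huU hw hf hvoc
  have hu0 : |u 0| ≤ U := huU 0 ⟨by linarith, le_rfl⟩
  have hvabs : ∀ t1 t2, 0 ≤ t1 → t1 ≤ t2 → |u t2| ≤ Real.exp (-a * (t2 - t1)) * |u t1| +
        |∫ s in t1..t2, Real.exp (-a * (t2 - s)) * f s| := by
    intro t1 t2 h1 h12
    rw [hvoc t1 t2 h1 h12]
    refine (abs_add_le _ _).trans ?_
    rw [abs_mul, Real.abs_exp]
  -- Step 1: bound on the initial interval
  have hstep1 : ∀ t ∈ Set.Icc 0 (r + ε), |u t| * Real.exp (-(4 * c) * t) ≤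
      (3 / 2 * U) / (1 - 1 / 2) := by
    obtain ⟨b, hb⟩ := (isCompact_Icc (a := (0:ℝ)) (b := r + ε)).exists_bound_of_continuousOn
      (f := fun t => |u t| * Real.exp (-(4 * c) * t)) (by fun_prop)
    refine boot (b := b) (by norm_num) (fun t _ => by positivity)
      (fun t ht => (le_abs_self _).trans (hb t ht)) ?_
    intro N hN hNb t ht
    have hfb : ∀ s ∈ Set.Icc 0 t, |f s| ≤ 2 * c * (U + N) * Real.exp (-(-(4 * c)) * s) := by
      intro s hs
      have hub : ∀ q ∈ Set.Icc (-(r + ε)) s, |u q| ≤ (U + N) * Real.exp (4 * c * s) := by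
        intro q hq
        have h1s : 1 ≤ Real.exp (4 * c * s) := Real.one_le_exp (by have := hs.1; positivity)
        rcases le_total q 0 with hq0 | hq0
        · have := huU q ⟨hq.1, hq0⟩
          nlinarith
        · have h1 := hNb q ⟨hq0, hq.2.trans (hs.2.trans ht.2)⟩
          have h2 : |u q| = |u q| * Real.exp (-(4 * c) * q) * Real.exp (4 * c * q) := by
            rw [mul_assoc, ← Real.exp_add]; simp
          have h3 : Real.exp (4 * c * q) ≤ Real.exp (4 * c * s) :=
            Real.exp_le_exp.2 (mul_le_mul_of_nonneg_left hq.2 (by positivity))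
          rw [h2]
          have h4 := Real.exp_pos (4 * c * q)
          calc _ ≤ N * Real.exp (4 * c * q) := by gcongr
            _ ≤ N * Real.exp (4 * c * s) := by gcongr
            _ ≤ _ := by gcongr; linarith
      obtain ⟨τ, hτ, hwτ⟩ := hw s hs.1
      have hA := hub (s - r + τ) ⟨by linarith [hτ.1, hs.1], by linarith [hτ.2]⟩
      have hB := hub (s - r) ⟨by linarith [hs.1], by linarith⟩
      have hC : |w s| ≤ 2 * ((U + N) * Real.exp (4 * c * s)) := by
        rw [hwτ]
        refine (abs_sub _ _).trans ?_
        linarith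
      refine (hf s hs.1).trans ?_
      rw [neg_neg]
      nlinarith
    have h1 := conv2 (a := a) (σ := -(4 * c)) (by linarith) (by positivity) ht.1 hfb
    have h2 := hvabs 0 t le_rfl ht.1
    have hex : Real.exp (-a * (t - 0)) ≤ 1 := Real.exp_le_one_iff.2 (by nlinarith [ht.1])
    have h3 : |u t| ≤ U + 2 * c * (U + N) * Real.exp (4 * c * t) / (a + 4 * c) := by
      rw [neg_neg, sub_neg_eq_add] at h1
      have : Real.exp (-a * (t - 0)) * |u 0| ≤ 1 * U := by gcongr
      linarith
    have h4 : 2 * c * (U + N) * Real.exp (4 * c * t) / (a + 4 * c) ≤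
        (U + N) / 2 * Real.exp (4 * c * t) := by
      rw [div_le_iff₀ (by positivity)]
      have : 0 ≤ (U + N) * Real.exp (4 * c * t) := by positivity
      nlinarith
    have h5 : Real.exp (4 * c * t) * Real.exp (-(4 * c) * t) = 1 := by
      rw [← Real.exp_add]; simp
    have h6 : Real.exp (-(4 * c) * t) ≤ 1 := Real.exp_le_one_iff.2 (by
      have := mul_nonneg hc ht.1; linarith)
    calc |u t| * Real.exp (-(4 * c) * t)
        ≤ (U + (U + N) / 2 * Real.exp (4 * c * t)) * Real.exp (-(4 * c) * t) := by
          gcongr; linarith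
      _ = U * Real.exp (-(4 * c) * t) + (U + N) / 2 *
          (Real.exp (4 * c * t) * Real.exp (-(4 * c) * t)) := by ring
      _ ≤ U * 1 + (U + N) / 2 * 1 := by rw [h5]; gcongr
      _ = _ := by ring
  have hstep1' : ∀ t ∈ Set.Icc (-(r + ε)) (r + ε), |u t| ≤ 3 * E * U := by
    intro t ht
    rcases le_total t 0 with h | h
    · have := huU t ⟨ht.1, h⟩
      nlinarith
    · have h1 := hstep1 t ⟨h, ht.2⟩
      have h2 : |u t| = |u t| * Real.exp (-(4 * c) * t) * Real.exp (4 * c * t) := by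
        rw [mul_assoc, ← Real.exp_add]; simp
      have h3 : Real.exp (4 * c * t) ≤ E :=
        Real.exp_le_exp.2 (mul_le_mul_of_nonneg_left ht.2 (by positivity))
      rw [h2]
      calc _ ≤ (3 / 2 * U) / (1 - 1 / 2) * E := by gcongr
        _ = _ := by ring
  -- Step 2: main bootstrap
  intro T hT
  have hstep2 : ∀ t ∈ Set.Icc 0 T, |w t| * Real.exp (σ * t) ≤
      ((6 * E * L + L * g) * U) / (1 - γ) := by
    obtain ⟨b, hb⟩ := (isCompact_Icc (a := -(r + ε)) (b := T)).exists_bound_of_continuousOn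
      (f := u) (by fun_prop)
    refine boot (b := 2 * b * Real.exp (σ * T)) hσγ (fun t _ => by positivity) ?_ ?_
    · intro t ht
      obtain ⟨τ, hτ, hwτ⟩ := hw t ht.1
      have hA := hb (t - r + τ) ⟨by linarith [hτ.1, ht.1], by linarith [hτ.2, ht.2]⟩
      have hB := hb (t - r) ⟨by linarith [ht.1], by linarith [ht.2]⟩
      rw [Real.norm_eq_abs] at hA hB
      have hC : |w t| ≤ 2 * b := by
        rw [hwτ]
        refine (abs_sub _ _).trans ?_
        linarith
      have : Real.exp (σ * t) ≤ Real.exp (σ * T) :=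
        Real.exp_le_exp.2 (mul_le_mul_of_nonneg_left ht.2 hσ0.le)
      have hb0 : 0 ≤ 2 * b := (abs_nonneg _).trans hC
      gcongr
    · intro N hN hNb t ht
      have hγ0 : 0 ≤ γ := by positivity
      rcases le_total t (r + ε) with h | h
      · obtain ⟨τ, hτ, hwτ⟩ := hw t ht.1
        have hA := hstep1' (t - r + τ) ⟨by linarith [hτ.1, ht.1], by linarith [hτ.2, ht.2]⟩
        have hB := hstep1' (t - r) ⟨by linarith [ht.1], by linarith [ht.2]⟩
        have hC : |w t| ≤ 6 * E * U := by
          rw [hwτ]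
          refine (abs_sub _ _).trans ?_
          linarith
        have h1 : Real.exp (σ * t) ≤ L :=
          Real.exp_le_exp.2 (mul_le_mul_of_nonneg_left h hσ0.le)
        have h2 : 0 ≤ L * g * U + γ * N := by positivity
        calc |w t| * Real.exp (σ * t) ≤ 6 * E * U * L := by gcongr
          _ ≤ _ := by linarith
      · have hfN : ∀ s ∈ Set.Icc 0 T, |f s| ≤ c * N * Real.exp (-σ * s) := by
          intro s hs
          refine (hf s hs.1).trans ?_
          have h1 := hNb s hs
          have h2 : |w s| = |w s| * Real.exp (σ * s) * Real.exp (-σ * s) := by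
            rw [mul_assoc, ← Real.exp_add]; simp
          rw [h2, mul_assoc c]
          gcongr
        have hdiff : ∀ t1 t2, t - r - ε ≤ t1 → t1 ≤ t2 → t2 ≤ t → t2 - t1 ≤ ε →
            |u t2 - u t1| ≤ g * (U + c * N * (1 / (a - σ) + 1 / a)) * Real.exp (-σ * t1) := by
          intro t1 t2 h1 h12 h2 hle
          have ht1 : 0 ≤ t1 := by linarith
          have hu1 : |u t1| ≤ (U + c * N / (a - σ)) * Real.exp (-σ * t1) := by
            have k1 := hvabs 0 t1 le_rfl ht1
            have k2 := conv2 (a := a) (D := c * N) hσa (by positivity) ht1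
              (fun s hs => hfN s ⟨hs.1, by linarith [hs.2, ht.2]⟩)
            have k3 : Real.exp (-a * (t1 - 0)) ≤ Real.exp (-σ * t1) :=
              Real.exp_le_exp.2 (by nlinarith)
            have k4 : Real.exp (-a * (t1 - 0)) * |u 0| ≤ Real.exp (-σ * t1) * U := by gcongr
            have k5 : c * N * Real.exp (-σ * t1) / (a - σ) =
              c * N / (a - σ) * Real.exp (-σ * t1) := by ring
            linarith
          have k6 := conv1 (a := a) (f := f) (D := c * N * Real.exp (-σ * t1)) ha h12 (by
            intro s hs
            refine (hfN s ⟨by linarith [hs.1], by linarith [hs.2, ht.2]⟩).trans ?_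
            have : Real.exp (-σ * s) ≤ Real.exp (-σ * t1) :=
              Real.exp_le_exp.2 (by nlinarith [hs.1])
            gcongr)
          have k7 : 1 - Real.exp (-a * (t2 - t1)) ≤ g := by
            have : Real.exp (-a * ε) ≤ Real.exp (-a * (t2 - t1)) :=
              Real.exp_le_exp.2 (by nlinarith)
            rw [hg]; linarith
          have k8 : 0 ≤ 1 - Real.exp (-a * (t2 - t1)) := by
            have : Real.exp (-a * (t2 - t1)) ≤ 1 := Real.exp_le_one_iff.2 (by nlinarith)
            linarith
          have k9 : |u t2 - u t1| ≤ (1 - Real.exp (-a * (t2 - t1))) * |u t1| +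
              |∫ s in t1..t2, Real.exp (-a * (t2 - s)) * f s| := by
            have : u t2 - u t1 = -((1 - Real.exp (-a * (t2 - t1))) * u t1) +
                ∫ s in t1..t2, Real.exp (-a * (t2 - s)) * f s := by
              rw [hvoc t1 t2 ht1 h12]; ring
            rw [this]
            refine (abs_add_le _ _).trans ?_
            rw [abs_neg, abs_mul, abs_of_nonneg k8]
          calc |u t2 - u t1| ≤ (1 - Real.exp (-a * (t2 - t1))) * |u t1| +
              c * N * Real.exp (-σ * t1) * (1 - Real.exp (-a * (t2 - t1))) / a := by linarith
            _ ≤ g * ((U + c * N / (a - σ)) * Real.exp (-σ * t1)) +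
              c * N * Real.exp (-σ * t1) * g / a := by gcongr
            _ = _ := by ring
        have hfin : ∀ t1, t - r - ε ≤ t1 → |w t| ≤
            g * (U + c * N * (1 / (a - σ) + 1 / a)) * Real.exp (-σ * t1) →
            |w t| * Real.exp (σ * t) ≤ (6 * E * L + L * g) * U + γ * N := by
          intro t1 h1 hwt
          have k1 : Real.exp (-σ * t1) * Real.exp (σ * t) ≤ L := by
            rw [← Real.exp_add]
            exact Real.exp_le_exp.2 (by nlinarith)
          have k2 : 0 ≤ 6 * E * L * U := by positivity
          calc |w t| * Real.exp (σ * t) ≤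
              g * (U + c * N * (1 / (a - σ) + 1 / a)) * Real.exp (-σ * t1) * Real.exp (σ * t) := by
                gcongr
            _ = g * (U + c * N * (1 / (a - σ) + 1 / a)) *
                (Real.exp (-σ * t1) * Real.exp (σ * t)) := by ring
            _ ≤ g * (U + c * N * (1 / (a - σ) + 1 / a)) * L := by gcongr
            _ = L * g * U + γ * N := by rw [hγ]; ring
            _ ≤ _ := by linarith
        obtain ⟨τ, hτ, hwτ⟩ := hw t ht.1
        rcases le_total 0 τ with hp | hp
        · refine hfin (t - r) (by linarith) ?_
          rw [hwτ]
          exact hdiff (t - r) (t - r + τ) (by linarith) (by linarith) (by linarith [hτ.2])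
            (by linarith [hτ.2])
        · refine hfin (t - r + τ) (by linarith [hτ.1]) ?_
          rw [hwτ, abs_sub_comm]
          exact hdiff (t - r + τ) (t - r) (by linarith [hτ.1]) (by linarith) (by linarith)
            (by linarith [hτ.1])
  have h1 := hstep2 T ⟨hT, le_rfl⟩
  have h2 : |w T| = |w T| * Real.exp (σ * T) * Real.exp (-σ * T) := by
    rw [mul_assoc, ← Real.exp_add]; simp
  rw [h2]
  calc _ ≤ ((6 * E * L + L * g) * U) / (1 - γ) * Real.exp (-σ * T) := by gcongr
    _ = _ := by ring

lemma qderiv {A B r : ℝ} {u : ℝ → ℝ} (hu : Continuous u) (t : ℝ) :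
    HasDerivAt (fun t => ∫ s in (t - r)..t, Real.exp (A * (t - s)) * (B * u s))
      (A * (∫ s in (t - r)..t, Real.exp (A * (t - s)) * (B * u s)) + B * u t -
        Real.exp (A * r) * B * u (t - r)) t := by
  have hc : Continuous (fun s => Real.exp (-A * s) * (B * u s)) := by fun_prop
  have hi : ∀ p q, IntervalIntegrable (fun s => Real.exp (-A * s) * (B * u s)) volume p q :=
    fun p q => hc.intervalIntegrable p q
  have hG : ∀ t, HasDerivAt (fun t => ∫ s in (0:ℝ)..t, Real.exp (-A * s) * (B * u s))
      (Real.exp (-A * t) * (B * u t)) t := fun t =>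
    intervalIntegral.integral_hasDerivAt_right (hi _ _)
      (hc.stronglyMeasurableAtFilter _ _) hc.continuousAt
  have heq : ∀ t, ∫ s in (t - r)..t, Real.exp (A * (t - s)) * (B * u s) =
      Real.exp (A * t) * ((∫ s in (0:ℝ)..t, Real.exp (-A * s) * (B * u s)) -
        ∫ s in (0:ℝ)..(t - r), Real.exp (-A * s) * (B * u s)) := by
    intro t
    rw [intervalIntegral.integral_interval_sub_left (hi _ _) (hi _ _),
      ← intervalIntegral.integral_const_mul]
    congr 1; ext s
    rw [← mul_assoc (Real.exp (A * t)), ← Real.exp_add]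
    congr 2; ring
  have hd := ((((hasDerivAt_id t).const_mul A).exp).mul
    ((hG t).sub ((hG (t - r)).comp_sub_const t r)))
  rw [funext heq]
  convert! hd using 1
  have e1 : Real.exp (A * t) * Real.exp (-A * t) = 1 := by rw [← Real.exp_add]; simp
  have e2 : Real.exp (A * t) * Real.exp (-A * (t - r)) = Real.exp (A * r) := by
    rw [← Real.exp_add]; congr 1; ring
  simp only [id, mul_one, Pi.sub_apply]
  rw [← e2, heq t]
  linear_combination (-B * u t) * e1

lemma qbound {A B r : ℝ} (hr : 0 ≤ r) {u : ℝ → ℝ} {t D : ℝ} (hD : 0 ≤ D)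
    (h : ∀ s ∈ Set.Icc (t - r) t, |u s| ≤ D) :
    |∫ s in (t - r)..t, Real.exp (A * (t - s)) * (B * u s)| ≤
      Real.exp (|A| * r) * |B| * r * D := by
  have := intervalIntegral.norm_integral_le_of_norm_le_const (a := t - r) (b := t)
    (f := fun s => Real.exp (A * (t - s)) * (B * u s)) (C := Real.exp (|A| * r) * (|B| * D)) (by
      intro s hs
      rw [Set.uIoc_of_le (by linarith)] at hs
      rw [Real.norm_eq_abs, abs_mul, abs_mul, Real.abs_exp]
      have h1 := h s (Set.Ioc_subset_Icc_self hs)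
      have h2 : A * (t - s) ≤ |A| * r := by
        calc A * (t - s) ≤ |A| * (t - s) := by
              gcongr
              · linarith [hs.2]
              · exact le_abs_self A
          _ ≤ |A| * r := by gcongr; linarith [hs.1]
      gcongr)
  rw [Real.norm_eq_abs] at this
  refine this.trans_eq ?_
  rw [show t - (t - r) = r by ring, abs_of_nonneg hr]; ring

set_option maxHeartbeats 4000000 in
theorem stmt_3 (A B k : ℝ) (hH : A + B * k < 0) (r ε : ℝ) (hε : 0 < ε) (hεr : ε ≤ r)
    (hsg : 2 * |B * k| * Real.exp (A * r) * (1 - Real.exp (-|A + B * k| * ε)) <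
      |A + B * k|) :
    ∃ Q σ : ℝ, 0 < Q ∧ 0 < σ ∧
      ∀ (d : ℝ → ℝ), Measurable d → (∀ t, 0 ≤ t → d t ∈ Set.Icc (-1 : ℝ) 1) →
        ∀ (x₀ : ℝ) (u₀ : ℝ → ℝ),
          ContinuousOn u₀ (Set.Icc (-(r + ε)) 0) →
          u₀ 0 = k * Real.exp (A * r) * x₀ +
            k * ∫ s in (-r : ℝ)..0, Real.exp (A * (-s)) * (B * u₀ s) →
          ∀ (x u : ℝ → ℝ),
            ContinuousOn x (Set.Ici 0) →
            ContinuousOn u (Set.Ici (-(r + ε))) →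
            x 0 = x₀ → (∀ t ∈ Set.Icc (-(r + ε)) (0 : ℝ), u t = u₀ t) →
            (∀ t : ℝ, 0 ≤ t →
              x t = x 0 + ∫ s in (0 : ℝ)..t,
                (A * x s + B * u (s - r - ε * d s))) →
            (∀ t : ℝ, 0 ≤ t →
              u t = k * Real.exp (A * r) * x t +
                k * ∫ s in t..(t + r), Real.exp (A * (t + r - s)) * (B * u (s - r))) →
            ∀ t : ℝ, 0 ≤ t →
              |x t| + sSup ((fun s => |u s|) '' Set.Icc (t - ε - r) t) ≤
                Q * Real.exp (-σ * t) *
                  (|x₀| + sSup ((fun s => |u₀ s|) '' Set.Icc (-ε - r) 0)) := by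
  obtain ⟨a, ha⟩ : ∃ a, a = |A + B * k| := ⟨_, rfl⟩
  have ha' : a = -(A + B * k) := by rw [ha, abs_of_neg hH]
  have ha0 : 0 < a := by linarith
  rw [← ha] at hsg
  have hr : 0 < r := by linarith
  obtain ⟨C, σ, hC, hσ, hσa, hcore⟩ := core (a := a) (c := |B * k| * Real.exp (A * r)) (r := r)
    (ε := ε) ha0 (by positivity) hε hεr (by rw [← mul_assoc]; exact hsg)
  have haσ : 0 < a - σ := by linarith
  obtain ⟨H, hHd⟩ : ∃ H, H = Real.exp (|A| * r) * |B| * r := ⟨_, rfl⟩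
  have hH0 : 0 ≤ H := by rw [hHd]; positivity
  obtain ⟨P, hPd⟩ : ∃ P, P = Real.exp (A * r) + H + Real.exp (A * r) * |B| * C / (a - σ) :=
    ⟨_, rfl⟩
  have hP0 : 0 < P := by rw [hPd]; positivity
  obtain ⟨V, hVd⟩ : ∃ V, V = |k| * P + 1 := ⟨_, rfl⟩
  have hV1 : 1 ≤ V := by rw [hVd]; have : 0 ≤ |k| * P := by positivity
                         linarith
  obtain ⟨L, hLd⟩ : ∃ L, L = Real.exp (σ * (r + ε)) := ⟨_, rfl⟩
  have hL0 : 0 < L := by rw [hLd]; positivity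
  refine ⟨Real.exp (-(A * r)) * (P + H * (V * L)) + V * L, σ, by positivity, hσ, ?_⟩
  intro d hdm hd x₀ u₀ hu₀c _ x u hxc huc hx0 huu hx hu
  -- extensions
  obtain ⟨ue, hue⟩ : ∃ ue : ℝ → ℝ, ue = fun s => u (max s (-(r + ε))) := ⟨_, rfl⟩
  obtain ⟨xe, hxe⟩ : ∃ xe : ℝ → ℝ, xe = fun s => x (max s 0) := ⟨_, rfl⟩
  have huec : Continuous ue := by
    rw [hue]
    exact huc.comp_continuous (by fun_prop) (fun s => Set.mem_Ici.2 (le_max_right _ _))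
  have hxec : Continuous xe := by
    rw [hxe]
    exact hxc.comp_continuous (by fun_prop) (fun s => Set.mem_Ici.2 (le_max_right _ _))
  have hueq : ∀ s, -(r + ε) ≤ s → ue s = u s := fun s hs => by rw [hue]; simp only [max_eq_left hs]
  have hxeq : ∀ s, 0 ≤ s → xe s = x s := fun s hs => by rw [hxe]; simp only [max_eq_left hs]
  obtain ⟨cl, hcl⟩ : ∃ cl : ℝ → ℝ, cl = fun s => max (-1) (min 1 (d s)) := ⟨_, rfl⟩
  have hclm : Measurable cl := by rw [hcl]; fun_prop
  have hclb : ∀ s, cl s ∈ Set.Icc (-1:ℝ) 1 := fun s => by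
    rw [hcl]; exact ⟨le_max_left _ _, max_le (by norm_num) (min_le_left _ _)⟩
  have hcleq : ∀ s, 0 ≤ s → cl s = d s := fun s hs => by
    rw [hcl]; have := hd s hs
    simp only [min_eq_right this.2, max_eq_right this.1]
  obtain ⟨v, hv⟩ : ∃ v : ℝ → ℝ, v = fun s => ue (s - r - ε * cl s) := ⟨_, rfl⟩
  have hvm : Measurable v := by
    rw [hv]
    exact huec.measurable.comp (by fun_prop)
  have hcle : ∀ s, |ε * cl s| ≤ ε := fun s => by
    rw [abs_mul, abs_of_pos hε]
    have := abs_le.2 (hclb s)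
    nlinarith
  have hvi : ∀ p q, IntervalIntegrable v volume p q := by
    intro p q
    obtain ⟨b, hb⟩ := (isCompact_Icc (a := min p q - r - ε)
      (b := max p q - r + ε)).exists_bound_of_continuousOn (f := ue) huec.continuousOn
    refine (intervalIntegrable_const (c := b)).mono_fun' hvm.aestronglyMeasurable ?_
    refine (ae_restrict_iff' measurableSet_uIoc).2 (Filter.Eventually.of_forall fun s hs => ?_)
    have hs1 : min p q < s := hs.1
    have hs2 : s ≤ max p q := hs.2
    have := abs_le.1 (hcle s)
    rw [hv]
    exact hb _ ⟨by linarith [this.2], by linarith [this.1]⟩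
  obtain ⟨w, hw⟩ : ∃ w : ℝ → ℝ, w = fun s => v s - ue (s - r) := ⟨_, rfl⟩
  obtain ⟨q, hq⟩ : ∃ q : ℝ → ℝ, q = fun t => ∫ s in (t - r)..t,
    Real.exp (A * (t - s)) * (B * ue s) := ⟨_, rfl⟩
  have hqd : ∀ t, HasDerivAt q (A * q t + B * ue t - Real.exp (A * r) * B * ue (t - r)) t := by
    intro t; rw [hq]; exact qderiv huec t
  have hqc : Continuous q := continuous_iff_continuousAt.2 fun t => (hqd t).continuousAt
  obtain ⟨p, hp⟩ : ∃ p : ℝ → ℝ, p = fun t => Real.exp (A * r) * xe t + q t := ⟨_, rfl⟩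
  have hup : ∀ t, 0 ≤ t → ue t = k * p t := by
    intro t ht
    rw [hueq t (by linarith), hu t ht, hp, hq]
    simp only
    rw [hxeq t ht]
    have e : ∫ s in t..(t + r), Real.exp (A * (t + r - s)) * (B * u (s - r)) =
        ∫ s in (t - r)..t, Real.exp (A * (t - s)) * (B * ue s) := by
      have := intervalIntegral.integral_comp_sub_right
        (fun s => Real.exp (A * (t - s)) * (B * ue s)) (a := t) (b := t + r) r
      rw [show t + r - r = t by ring] at this
      rw [← this]
      apply intervalIntegral.integral_congr
      intro s hs
      rw [Set.uIcc_of_le (by linarith)] at hs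
      simp only
      rw [hueq (s - r) (by linarith [hs.1]), show t + r - s = t - (s - r) by ring]
    rw [e]; ring
  have hxint : ∀ t, 0 ≤ t → xe t = xe 0 + ∫ s in (0:ℝ)..t, (A * xe s + B * v s) := by
    intro t ht
    rw [hxeq t ht, hxeq 0 le_rfl, hx t ht]
    congr 1
    apply intervalIntegral.integral_congr
    intro s hs
    rw [Set.uIcc_of_le ht] at hs
    simp only
    have := hd s hs.1
    rw [hxeq s hs.1, hv]
    simp only
    rw [hcleq s hs.1, hueq]
    nlinarith [this.2, hs.1]
  have hxi : ∀ p q, IntervalIntegrable (fun s => A * xe s + B * v s) volume p q := fun p q =>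
    ((hxec.intervalIntegrable p q).const_mul A).add ((hvi p q).const_mul B)
  have hqi : ∀ p' q', IntervalIntegrable
      (fun s => A * q s + B * ue s - Real.exp (A * r) * B * ue (s - r)) volume p' q' := fun p' q' =>
    Continuous.intervalIntegrable (by fun_prop) _ _
  have hpint : ∀ t, 0 ≤ t → p t = p 0 + ∫ s in (0:ℝ)..t, (Real.exp (A * r) * (A * xe s + B * v s) +
      (A * q s + B * ue s - Real.exp (A * r) * B * ue (s - r))) := by
    intro t ht
    rw [intervalIntegral.integral_add ((hxi _ _).const_mul _) (hqi _ _),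
      intervalIntegral.integral_const_mul,
      intervalIntegral.integral_eq_sub_of_hasDerivAt (fun s _ => hqd s) (hqi _ _), hp]
    simp only
    rw [hxint t ht]
    ring
  have hvocp : ∀ t1 t2, 0 ≤ t1 → t1 ≤ t2 → p t2 = Real.exp (-a * (t2 - t1)) * p t1 +
      ∫ s in t1..t2, Real.exp (-a * (t2 - s)) * (Real.exp (A * r) * B * w s) := by
    intro t1 t2 h1 h12
    refine voc (f := fun s => Real.exp (A * r) * B * w s)
      (fun p' q' => ((hxi p' q').const_mul (Real.exp (A * r))).add (hqi p' q')) hpint ?_ h1 h12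
    intro s hs
    have e1 := hup s hs
    have e2 : p s = Real.exp (A * r) * xe s + q s := by rw [hp]
    rw [ha', e1, hw]
    simp only
    linear_combination (-A) * e2
  obtain ⟨U, hUd⟩ : ∃ U, U = sSup ((fun s => |u₀ s|) '' Set.Icc (-ε - r) 0) := ⟨_, rfl⟩
  have hset : -(r + ε) = -ε - r := by ring
  have huU : ∀ t ∈ Set.Icc (-(r + ε)) 0, |ue t| ≤ U := by
    intro t ht
    rw [hueq t ht.1, huu t ht, hUd]
    rw [hset] at ht hu₀c
    exact le_csSup (isCompact_Icc.bddAbove_image hu₀c.abs) ⟨t, ht, rfl⟩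
  have hU0 : 0 ≤ U := (abs_nonneg _).trans (huU 0 ⟨by linarith, le_rfl⟩)
  have hwb : ∀ t, 0 ≤ t → |w t| ≤ C * U * Real.exp (-σ * t) := by
    refine hcore ue w (fun s => k * (Real.exp (A * r) * B * w s)) U huec hU0 huU ?_ ?_ ?_
    · intro t _
      have := abs_le.1 (hcle t)
      refine ⟨-(ε * cl t), ⟨by linarith [this.2], by linarith [this.1]⟩, ?_⟩
      rw [hw, hv]
      simp only [sub_eq_add_neg]
    · intro t _
      simp only [abs_mul, Real.abs_exp]
      apply le_of_eq; ring
    · intro t1 t2 h1 h12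
      rw [hup t2 (h1.trans h12), hup t1 h1, hvocp t1 t2 h1 h12, mul_add,
        ← intervalIntegral.integral_const_mul]
      congr 1
      · ring
      · congr 1; ext s; ring
  rw [← hUd]
  have hX : 0 ≤ |x₀| := abs_nonneg _
  obtain ⟨Z, hZ⟩ : ∃ Z, Z = |x₀| + U := ⟨_, rfl⟩
  have hZ0 : 0 ≤ Z := by rw [hZ]; positivity
  have hUZ : U ≤ Z := by rw [hZ]; linarith
  have hXZ : |x₀| ≤ Z := by rw [hZ]; linarith
  rw [← hZ]
  have hqb : ∀ t D, 0 ≤ D → (∀ s ∈ Set.Icc (t - r) t, |ue s| ≤ D) → |q t| ≤ H * D := by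
    intro t D hD h
    rw [hq, hHd]
    exact qbound hr.le hD h
  have hp0 : |p 0| ≤ (Real.exp (A * r) + H) * Z := by
    have h1 := hqb 0 U hU0 (fun s hs => huU s ⟨by linarith [hs.1], hs.2⟩)
    have h2 : |p 0| ≤ Real.exp (A * r) * |x₀| + |q 0| := by
      rw [hp]
      refine (abs_add_le _ _).trans ?_
      rw [abs_mul, Real.abs_exp, hxeq 0 le_rfl, hx0]
    calc |p 0| ≤ Real.exp (A * r) * |x₀| + H * U := by linarith
      _ ≤ Real.exp (A * r) * Z + H * Z := by gcongr
      _ = _ := by ring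
  have hpb : ∀ t, 0 ≤ t → |p t| ≤ P * Z * Real.exp (-σ * t) := by
    intro t ht
    have h1 := conv2 (a := a) (σ := σ) (D := Real.exp (A * r) * |B| * (C * U))
      (f := fun s => Real.exp (A * r) * B * w s) hσa (by positivity) ht (by
        intro s hs
        simp only [abs_mul, Real.abs_exp]
        rw [mul_assoc (Real.exp (A * r) * |B|)]
        have := hwb s hs.1
        gcongr)
    have h2 : |p t| ≤ Real.exp (-a * (t - 0)) * |p 0| +
        |∫ s in (0:ℝ)..t, Real.exp (-a * (t - s)) * (Real.exp (A * r) * B * w s)| := by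
      rw [hvocp 0 t le_rfl ht]
      refine (abs_add_le _ _).trans ?_
      rw [abs_mul, Real.abs_exp]
    have h3 : Real.exp (-a * (t - 0)) ≤ Real.exp (-σ * t) := Real.exp_le_exp.2 (by nlinarith)
    calc |p t| ≤ Real.exp (-a * (t - 0)) * |p 0| +
          Real.exp (A * r) * |B| * (C * U) * Real.exp (-σ * t) / (a - σ) := by linarith
      _ ≤ Real.exp (-σ * t) * ((Real.exp (A * r) + H) * Z) +
          Real.exp (A * r) * |B| * (C * Z) * Real.exp (-σ * t) / (a - σ) := by gcongr
      _ = _ := by rw [hPd]; ring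
  have hub : ∀ s, -(r + ε) ≤ s → |ue s| ≤ V * Z * Real.exp (-σ * s) := by
    intro s hs
    rcases le_total s 0 with h | h
    · have h1 := huU s ⟨hs, h⟩
      have h2 : 1 ≤ Real.exp (-σ * s) := Real.one_le_exp (by nlinarith)
      calc |ue s| ≤ 1 * Z * 1 := by linarith
        _ ≤ _ := by gcongr
    · rw [hup s h, abs_mul]
      have h1 := hpb s h
      calc |k| * |p s| ≤ |k| * (P * Z * Real.exp (-σ * s)) := by gcongr
        _ = (|k| * P) * Z * Real.exp (-σ * s) := by ring
        _ ≤ _ := by rw [hVd]; gcongr; linarith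
  intro t ht
  have hwin : ∀ s ∈ Set.Icc (t - ε - r) t, |ue s| ≤ V * L * Z * Real.exp (-σ * t) := by
    intro s hs
    have h1 := hub s (by linarith [hs.1])
    have h2 : Real.exp (-σ * s) ≤ L * Real.exp (-σ * t) := by
      rw [hLd, ← Real.exp_add]
      exact Real.exp_le_exp.2 (by nlinarith [hs.1])
    calc |ue s| ≤ V * Z * Real.exp (-σ * s) := h1
      _ ≤ V * Z * (L * Real.exp (-σ * t)) := by gcongr
      _ = _ := by ring
  have hS : sSup ((fun s => |u s|) '' Set.Icc (t - ε - r) t) ≤ V * L * Z * Real.exp (-σ * t) := by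
    refine csSup_le ⟨_, t, ⟨by linarith, le_rfl⟩, rfl⟩ ?_
    rintro _ ⟨s, hs, rfl⟩
    simp only
    rw [← hueq s (by linarith [hs.1])]
    exact hwin s hs
  have hqt := hqb t (V * L * Z * Real.exp (-σ * t)) (by positivity)
    (fun s hs => hwin s ⟨by linarith [hs.1], hs.2⟩)
  have hxt : |x t| ≤ Real.exp (-(A * r)) * (|p t| + |q t|) := by
    have e : x t = Real.exp (-(A * r)) * (p t - q t) := by
      rw [hp]
      simp only
      rw [hxeq t ht, add_sub_cancel_right, ← mul_assoc, ← Real.exp_add]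
      simp
    rw [e, abs_mul, Real.abs_exp]
    gcongr
    exact abs_sub _ _
  have hpt := hpb t ht
  calc _ ≤ Real.exp (-(A * r)) * (P * Z * Real.exp (-σ * t) +
        H * (V * L * Z * Real.exp (-σ * t))) + V * L * Z * Real.exp (-σ * t) := by
        refine add_le_add (hxt.trans ?_) hS
        gcongr
    _ = _ := by ring
end

section
/- Let p > 1 and let ε > 0 satisfy ε < (1/(p−1)) · ln(2pe / (2pe − p + 1)). Then the scalar closed-loop system ẋ(t) = x(t) + u(t−1−εd(t)) with feedback u(t) = −p e x(t) − p ∫_0^1 e^{s} u(t−s) ds is robustly globally exponentially stable: there exist constants Q, σ > 0 such that for every measurable d : [0,∞) → [−1,1] and every solution (x, u) with compatible continuous initial data on [−1−ε, 0], the estimate |x(t)| + max_{t−1−ε ≤ s ≤ t} |u(s)| ≤ Q e^{−σt} (|x(0)| + max_{−1−ε ≤ s ≤ 0} |u(s)|) holds for all t ≥ 0. -/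
open MeasureTheory

lemma aux_ac_const (c a b : ℝ) : AbsolutelyContinuousOnInterval (fun _ : ℝ => c) a b :=
  ((LipschitzWith.const c).lipschitzOnWith (s := Set.uIcc a b)).absolutelyContinuousOnInterval

lemma aux_ac_exp (c a b : ℝ) :
    AbsolutelyContinuousOnInterval (fun s : ℝ => Real.exp (c * s)) a b := by
  have h1 : IntervalIntegrable (fun s => c * Real.exp (c * s)) volume a b :=
    Continuous.intervalIntegrable (by fun_prop) _ _
  have h2 := (aux_ac_const (Real.exp (c * a)) a b).add
    (h1.absolutelyContinuousOnInterval_intervalIntegral (c := a) (by simp))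
  have h4 : (fun s : ℝ => Real.exp (c * s)) = (fun _ : ℝ => Real.exp (c * a)) +
      fun x => ∫ v in a..x, c * Real.exp (c * v) := by
    funext t
    have h3 : ∫ s in a..t, c * Real.exp (c * s) = Real.exp (c * t) - Real.exp (c * a) := by
      apply intervalIntegral.integral_eq_sub_of_hasDerivAt (f := fun s => Real.exp (c * s))
      · intro s _
        have := ((hasDerivAt_id s).const_mul c).exp
        simp only [id, mul_one] at this
        rw [mul_comm]; exact this
      · exact Continuous.intervalIntegrable (by fun_prop) _ _
    simp only [Pi.add_apply]
    rw [h3]; ring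
  rw [h4]; exact h2

/-- variation of constants -/
lemma aux_vc (c T y0 : ℝ) (hT : 0 ≤ T) (y f : ℝ → ℝ) (hy : Continuous y)
    (hf : IntervalIntegrable f volume 0 T)
    (h : ∀ t, 0 ≤ t → y t = y0 + ∫ s in (0:ℝ)..t, (c * y s + f s)) :
    Real.exp (-c * T) * y T = y0 + ∫ s in (0:ℝ)..T, Real.exp (-c * s) * f s := by
  have hg : IntervalIntegrable (fun s => c * y s + f s) volume 0 T :=
    (Continuous.intervalIntegrable (by fun_prop) _ _).add hf
  have hG := (aux_ac_const y0 0 T).add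
    (hg.absolutelyContinuousOnInterval_intervalIntegral (c := 0) (by simp))
  have key := (aux_ac_exp (-c) 0 T).integral_deriv_mul_eq_sub hG
  have hd := hg.ae_hasDerivAt_integral
  rw [intervalIntegral.integral_congr_ae
    (g := fun s => Real.exp (-c * s) * f s) ?_] at key
  · rw [key, h T hT]; simp
  · filter_upwards [hd] with s hs hs1
    have hs2 := Set.uIoc_subset_uIcc hs1
    have hs3 := (hs hs2 0 (by simp)).const_add y0
    rw [Set.uIcc_of_le hT] at hs2
    have e1 : deriv ((fun _ : ℝ => y0) + fun x => ∫ v in (0:ℝ)..x, (c * y v + f v)) s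
        = c * y s + f s := hs3.deriv
    have e2 : deriv (fun s : ℝ => Real.exp (-c * s)) s = Real.exp (-c * s) * -c := by
      have := ((hasDerivAt_id s).const_mul (-c)).exp
      simp only [id, mul_one] at this
      exact this.deriv
    rw [e1, e2]
    simp only [Pi.add_apply]
    rw [← h s hs2.1]; ring

lemma aux_int (ε T : ℝ) (hε : 0 < ε) (hT : 0 ≤ T) (d u : ℝ → ℝ) (hd : Measurable d)
    (hd1 : ∀ t, d t ∈ Set.Icc (-1 : ℝ) 1) (hu : Continuous u) :
    IntervalIntegrable (fun s => u (s - 1 - ε * d s)) volume 0 T := by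
  obtain ⟨C, hC⟩ := (isCompact_Icc (a := -1 - ε) (b := T - 1 + ε)).exists_bound_of_continuousOn
    hu.continuousOn
  have hm : Measurable (fun s => u (s - 1 - ε * d s)) := hu.measurable.comp (by fun_prop)
  refine (intervalIntegrable_const (c := C)).mono_fun' hm.aestronglyMeasurable ?_
  refine (ae_restrict_iff' measurableSet_uIoc).2 (Filter.Eventually.of_forall fun s hs => ?_)
  rw [Set.uIoc_of_le hT] at hs
  apply hC
  obtain ⟨h1, h2⟩ := hd1 s
  constructor <;> nlinarith [hs.1, hs.2]

lemma aux_formula (p ε : ℝ) (hε : 0 < ε) (d x u : ℝ → ℝ) (hd : Measurable d)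
    (hd1 : ∀ t, d t ∈ Set.Icc (-1 : ℝ) 1) (hx : Continuous x) (hu : Continuous u)
    (hX : ∀ t : ℝ, 0 ≤ t →
            x t = x 0 + ∫ s in (0 : ℝ)..t, (x s + u (s - 1 - ε * d s)))
    (hU : ∀ t : ℝ, 0 ≤ t →
            u t = -p * Real.exp 1 * x t -
              p * ∫ s in (0 : ℝ)..1, Real.exp s * u (t - s)) (t : ℝ) (ht : 0 ≤ t) :
    Real.exp ((p - 1) * t) * u t = u 0 + ∫ s in (0:ℝ)..t, Real.exp ((p - 1) * s) *
      (-p * Real.exp 1 * (u (s - 1 - ε * d s) - u (s - 1))) := by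
  have hw := fun T hT => aux_int ε T hε hT d u hd hd1 hu
  -- predictor integral
  have hP : ∀ t : ℝ, Real.exp (-t) * ∫ s in (0 : ℝ)..1, Real.exp s * u (t - s) =
      (∫ r in (-1:ℝ)..0, Real.exp (-r) * u r) + (∫ s in (0:ℝ)..t, Real.exp (-s) * u s)
       - ∫ s in (0:ℝ)..t, Real.exp (-s) * (Real.exp 1 * u (s - 1)) := by
    intro t
    have hi : ∀ a b : ℝ, IntervalIntegrable (fun r => Real.exp (-r) * u r) volume a b :=
      fun a b => Continuous.intervalIntegrable (by fun_prop) _ _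
    have e1 : Real.exp (-t) * ∫ s in (0 : ℝ)..1, Real.exp s * u (t - s) =
        ∫ r in (t-1)..t, Real.exp (-r) * u r := by
      rw [← intervalIntegral.integral_const_mul]
      have := intervalIntegral.integral_comp_sub_left (a := 0) (b := 1)
        (fun r => Real.exp (-r) * u r) t
      rw [sub_zero] at this
      rw [← this]
      apply intervalIntegral.integral_congr
      intro s _
      simp only
      rw [← mul_assoc, ← Real.exp_add]; ring_nf
    have e2 : ∫ s in (0:ℝ)..t, Real.exp (-s) * (Real.exp 1 * u (s - 1)) =
        ∫ r in (-1:ℝ)..(t-1), Real.exp (-r) * u r := by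
      have := intervalIntegral.integral_comp_sub_right (a := 0) (b := t)
        (fun r => Real.exp (-r) * u r) 1
      rw [zero_sub] at this
      rw [← this]
      apply intervalIntegral.integral_congr
      intro s _
      simp only
      rw [← mul_assoc, ← Real.exp_add]; ring_nf
    rw [e1, e2]
    have a1 := intervalIntegral.integral_add_adjacent_intervals (hi (-1) 0) (hi 0 t)
    have a2 := intervalIntegral.integral_add_adjacent_intervals (hi (-1) (t-1)) (hi (t-1) t)
    linarith
  -- formula for x
  have hx1 : ∀ t, 0 ≤ t → Real.exp (-t) * x t = x 0 +
      ∫ s in (0:ℝ)..t, Real.exp (-s) * u (s - 1 - ε * d s) := by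
    intro t ht
    have := aux_vc 1 t (x 0) ht x _ hx (hw t ht) (by simpa using hX)
    simpa using this
  have hy : ∀ t, 0 ≤ t → Real.exp (-t) * u t = u 0 + ∫ s in (0:ℝ)..t,
      ((-p) * (Real.exp (-s) * u s) + Real.exp (-s) *
        (-p * Real.exp 1 * (u (s - 1 - ε * d s) - u (s - 1)))) := by
    intro t ht
    have f1 := hU 0 le_rfl
    have f2 := hP 0
    simp only [neg_zero, Real.exp_zero, one_mul, intervalIntegral.integral_same, add_zero,
      sub_zero] at f2
    rw [f2] at f1
    have f3 := hP t
    have f4 := hx1 t ht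
    have i1 : IntervalIntegrable (fun s => Real.exp (-s) * u s) volume 0 t :=
      Continuous.intervalIntegrable (by fun_prop) _ _
    have i2 : IntervalIntegrable (fun s => Real.exp (-s) * u (s - 1 - ε * d s)) volume 0 t :=
      (hw t ht).continuousOn_mul (by fun_prop)
    have i3 : IntervalIntegrable (fun s => Real.exp (-s) * (Real.exp 1 * u (s - 1))) volume 0 t :=
      Continuous.intervalIntegrable (by fun_prop) _ _
    have f5 : ∫ s in (0:ℝ)..t,
      ((-p) * (Real.exp (-s) * u s) + Real.exp (-s) *
        (-p * Real.exp 1 * (u (s - 1 - ε * d s) - u (s - 1)))) =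
        (-p) * (∫ s in (0:ℝ)..t, Real.exp (-s) * u s) +
        (-p * Real.exp 1) * (∫ s in (0:ℝ)..t, Real.exp (-s) * u (s - 1 - ε * d s)) +
        p * ∫ s in (0:ℝ)..t, Real.exp (-s) * (Real.exp 1 * u (s - 1)) := by
      rw [← intervalIntegral.integral_const_mul, ← intervalIntegral.integral_const_mul,
        ← intervalIntegral.integral_const_mul, ← intervalIntegral.integral_add,
        ← intervalIntegral.integral_add]
      · apply intervalIntegral.integral_congr
        intro s _
        simp only
        ring
      · exact (i1.const_mul _).add (i2.const_mul _)
      · exact i3.const_mul _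
      · exact i1.const_mul _
      · exact i2.const_mul _
    rw [f5, hU t ht]
    linear_combination (-p) * f3 + (-p * Real.exp 1) * f4 - f1
  have i4 : IntervalIntegrable (fun s => Real.exp (-s) *
        (-p * Real.exp 1 * (u (s - 1 - ε * d s) - u (s - 1)))) volume 0 t :=
    (((hw t ht).sub (Continuous.intervalIntegrable (by fun_prop) _ _)).const_mul _).continuousOn_mul
      (by fun_prop)
  have := aux_vc (-p) t (u 0) ht (fun s => Real.exp (-s) * u s) _ (by fun_prop) i4 hy
  rw [← mul_assoc, ← Real.exp_add] at this
  rw [show (p - 1) * t = - -p * t + -t by ring, this]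
  congr 1
  apply intervalIntegral.integral_congr
  intro s _
  simp only
  rw [← mul_assoc, ← Real.exp_add]; ring_nf

lemma aux_expint (b t1 t2 : ℝ) (hb : b ≠ 0) :
    ∫ s in t1..t2, Real.exp (b * s) = (Real.exp (b * t2) - Real.exp (b * t1)) / b := by
  rw [intervalIntegral.integral_comp_mul_left _ hb, integral_exp, smul_eq_mul]
  field_simp

lemma aux_L (a b D t1 t2 : ℝ) (u q : ℝ → ℝ) (hb : b ≠ 0) (h1 : 0 ≤ t1) (h12 : t1 ≤ t2)
    (hqi : ∀ T, 0 ≤ T → IntervalIntegrable q volume 0 T)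
    (hF : ∀ t, 0 ≤ t → Real.exp (a * t) * u t = u 0 + ∫ s in (0:ℝ)..t, Real.exp (a * s) * q s)
    (hq : ∀ s, t1 ≤ s → s ≤ t2 → |q s| ≤ D * Real.exp ((b - a) * s)) :
    |Real.exp (a * t2) * u t2 - Real.exp (a * t1) * u t1| ≤
      D * ((Real.exp (b * t2) - Real.exp (b * t1)) / b) := by
  have hi : ∀ T, 0 ≤ T → IntervalIntegrable (fun s => Real.exp (a * s) * q s) volume 0 T :=
    fun T hT => (hqi T hT).continuousOn_mul (by fun_prop)
  have e := intervalIntegral.integral_interval_sub_left (hi t2 (h1.trans h12)) (hi t1 h1)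
  rw [hF t2 (h1.trans h12), hF t1 h1, add_sub_add_left_eq_sub, e, ← aux_expint b t1 t2 hb,
    ← intervalIntegral.integral_const_mul, ← Real.norm_eq_abs]
  apply intervalIntegral.norm_integral_le_of_norm_le h12
  · refine Filter.Eventually.of_forall fun s hs => ?_
    rw [norm_mul, Real.norm_eq_abs, Real.norm_eq_abs, Real.abs_exp]
    calc Real.exp (a * s) * |q s| ≤ Real.exp (a * s) * (D * Real.exp ((b - a) * s)) := by
          gcongr; exact hq s hs.1.le hs.2
      _ = D * (Real.exp (a * s) * Real.exp ((b - a) * s)) := by ring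
      _ = D * Real.exp (b * s) := by rw [← Real.exp_add]; ring_nf
  · exact Continuous.intervalIntegrable (by fun_prop) _ _

lemma aux_phase1 (a ε G M : ℝ) (ha : 0 < a) (hε : 0 < ε) (hε1 : ε < 1) (hG : 0 < G)
    (d u q : ℝ → ℝ) (hd1 : ∀ t, d t ∈ Set.Icc (-1 : ℝ) 1) (hu : Continuous u)
    (hqi : ∀ T, 0 ≤ T → IntervalIntegrable q volume 0 T)
    (hF : ∀ t, 0 ≤ t → Real.exp (a * t) * u t = u 0 + ∫ s in (0:ℝ)..t, Real.exp (a * s) * q s)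
    (hq : ∀ s, |q s| ≤ G * |u (s - 1 - ε * d s) - u (s - 1)|)
    (hM : ∀ s, -1 - ε ≤ s → s ≤ 0 → |u s| ≤ M) :
    ∀ s, -1 - ε ≤ s → s ≤ 2 → |u s| ≤ 2 * Real.exp (16 * G) * M := by
  obtain ⟨s0, hs0, hmax⟩ := (isCompact_Icc (a := -1 - ε) (b := 2)).exists_isMaxOn
    ⟨0, by constructor <;> linarith⟩
    (f := fun s => Real.exp (-(4 * G) * s) * |u s|) (by fun_prop)
  set B := Real.exp (-(4 * G) * s0) * |u s0| with hB
  have hB0 : 0 ≤ B := by positivity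
  have hM0 : 0 ≤ M := (abs_nonneg _).trans (hM 0 (by linarith) le_rfl)
  have hub : ∀ s, -1 - ε ≤ s → s ≤ 2 → |u s| ≤ B * Real.exp (4 * G * s) := by
    intro s h1 h2
    have h3 : Real.exp (-(4 * G) * s) * |u s| ≤ B := hmax ⟨h1, h2⟩
    calc |u s| = (Real.exp (-(4 * G) * s) * |u s|) * Real.exp (4 * G * s) := by
          rw [mul_comm, ← mul_assoc, ← Real.exp_add]; ring_nf; simp
      _ ≤ _ := by gcongr
  have hus0 : |u s0| = B * Real.exp (4 * G * s0) := by
    rw [hB, mul_comm, ← mul_assoc, ← Real.exp_add]; ring_nf; simp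
  have hBM : B ≤ 2 * Real.exp (8 * G) * M := by
    rcases le_or_gt s0 0 with h | h
    · have e1 : Real.exp (-(4 * G) * s0) ≤ Real.exp (8 * G) := by
        apply Real.exp_le_exp.2; nlinarith [hs0.1]
      calc B ≤ Real.exp (8 * G) * M := by
            rw [hB]; gcongr; exact hM _ hs0.1 h
        _ ≤ _ := by nlinarith [mul_nonneg (Real.exp_pos (8*G)).le hM0]
    · have hL := aux_L a (a + 4 * G) (2 * G * B) 0 s0 u q (by positivity) le_rfl h.le hqi hF (by
        intro s h1 h2
        obtain ⟨g1, g2⟩ := hd1 s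
        have hs2 := hs0.2
        have k1 := hub (s - 1 - ε * d s) (by nlinarith) (by nlinarith)
        have k2 := hub (s - 1) (by nlinarith) (by nlinarith)
        have k3 : Real.exp (4 * G * (s - 1 - ε * d s)) ≤ Real.exp (4 * G * s) := by
          apply Real.exp_le_exp.2; apply mul_le_mul_of_nonneg_left _ (by positivity); nlinarith
        have k4 : Real.exp (4 * G * (s - 1)) ≤ Real.exp (4 * G * s) := by
          apply Real.exp_le_exp.2; apply mul_le_mul_of_nonneg_left _ (by positivity); nlinarith
        calc |q s| ≤ G * |u (s - 1 - ε * d s) - u (s - 1)| := hq s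
          _ ≤ G * (|u (s - 1 - ε * d s)| + |u (s - 1)|) := by gcongr; exact abs_sub _ _
          _ ≤ G * (B * Real.exp (4 * G * s) + B * Real.exp (4 * G * s)) := by
              gcongr
              · exact k1.trans (by gcongr)
              · exact k2.trans (by gcongr)
          _ = 2 * G * B * Real.exp ((a + 4 * G - a) * s) := by ring_nf)
      simp only [mul_zero, Real.exp_zero, one_mul] at hL
      have h0 := hM 0 (by linarith) le_rfl
      have h5 : Real.exp (a * s0) * |u s0| ≤ M + 2 * G * B *
          ((Real.exp ((a + 4 * G) * s0) - 1) / (a + 4 * G)) := by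
        have := abs_sub_abs_le_abs_sub (Real.exp (a * s0) * u s0) (u 0)
        rw [abs_mul, Real.abs_exp] at this
        linarith
      have h6 : Real.exp (a * s0) * |u s0| = B * Real.exp ((a + 4 * G) * s0) := by
        rw [hus0, mul_left_comm, ← Real.exp_add]; ring_nf
      set X := Real.exp ((a + 4 * G) * s0) with hX
      have hX1 : 1 ≤ X := Real.one_le_exp (by positivity)
      have h7 : 2 * G * B * ((X - 1) / (a + 4 * G)) ≤ B * X / 2 := by
        rw [← mul_div_assoc, div_le_iff₀ (by positivity)]
        nlinarith [mul_nonneg hG.le hB0, mul_nonneg (mul_nonneg hB0 ha.le) (by linarith : 0 ≤ X)]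
      have h8 : B ≤ 2 * M := by nlinarith
      have h9 : 1 ≤ Real.exp (8 * G) := Real.one_le_exp (by positivity)
      nlinarith
  intro s h1 h2
  calc |u s| ≤ B * Real.exp (4 * G * s) := hub s h1 h2
    _ ≤ (2 * Real.exp (8 * G) * M) * Real.exp (8 * G) := by
        have : Real.exp (4 * G * s) ≤ Real.exp (8 * G) := Real.exp_le_exp.2 (by nlinarith)
        gcongr
    _ = _ := by
        rw [show 16 * G = 8 * G + 8 * G by ring, Real.exp_add]; ring

lemma aux_bound (a σ V M T t : ℝ) (ha : 0 < a) (hσ : 0 < σ) (hσa : σ < a)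
    (u q : ℝ → ℝ) (hV : 0 ≤ V)
    (hqi : ∀ T, 0 ≤ T → IntervalIntegrable q volume 0 T)
    (hF : ∀ t, 0 ≤ t → Real.exp (a * t) * u t = u 0 + ∫ s in (0:ℝ)..t, Real.exp (a * s) * q s)
    (hq : ∀ s, 0 ≤ s → s ≤ T → |q s| ≤ V * Real.exp (-σ * s))
    (h0 : |u 0| ≤ M) (ht : 0 ≤ t) (htT : t ≤ T) :
    |u t| ≤ Real.exp (-σ * t) * (M + V / (a - σ)) := by
  have hL := aux_L a (a - σ) V 0 t u q (by linarith) le_rfl ht hqi hF (by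
    intro s h1 h2
    rw [show a - σ - a = -σ by ring]
    exact hq s h1 (h2.trans htT))
  simp only [mul_zero, Real.exp_zero, one_mul] at hL
  have := abs_sub_abs_le_abs_sub (Real.exp (a * t) * u t) (u 0)
  rw [abs_mul, Real.abs_exp] at this
  have haσ : 0 < a - σ := by linarith
  have hX1 : 1 ≤ Real.exp ((a - σ) * t) := Real.one_le_exp (by positivity)
  have hM : 0 ≤ M := (abs_nonneg _).trans h0
  have h3 : Real.exp (a * t) * |u t| ≤ Real.exp ((a - σ) * t) * (M + V / (a - σ)) := by
    have h4 : V * ((Real.exp ((a - σ) * t) - 1) / (a - σ)) =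
      Real.exp ((a - σ) * t) * (V / (a - σ)) - V / (a - σ) := by ring
    have h5 : 0 ≤ V / (a - σ) := by positivity
    nlinarith
  have h6 : Real.exp ((a - σ) * t) = Real.exp (a * t) * Real.exp (-σ * t) := by
    rw [← Real.exp_add]; ring_nf
  rw [h6, mul_assoc] at h3
  exact le_of_mul_le_mul_left h3 (Real.exp_pos _)

lemma aux_diff (a ε σ V M T t1 t2 : ℝ) (ha : 0 < a) (hσ : 0 < σ) (hσa : σ < a)
    (u q : ℝ → ℝ) (hV : 0 ≤ V)
    (hqi : ∀ T, 0 ≤ T → IntervalIntegrable q volume 0 T)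
    (hF : ∀ t, 0 ≤ t → Real.exp (a * t) * u t = u 0 + ∫ s in (0:ℝ)..t, Real.exp (a * s) * q s)
    (hq : ∀ s, 0 ≤ s → s ≤ T → |q s| ≤ V * Real.exp (-σ * s))
    (h0 : |u 0| ≤ M) (h1 : 0 ≤ t1) (h12 : t1 ≤ t2) (h2T : t2 ≤ T) (hδ : t2 - t1 ≤ ε) :
    |u t2 - u t1| ≤ (1 - Real.exp (-a * ε)) * Real.exp (-σ * t1) *
      (M + V * (1 / (a - σ) + 1 / a)) := by
  have hb := aux_bound a σ V M T t1 ha hσ hσa u q hV hqi hF hq h0 h1 (h12.trans h2T)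
  have hL := aux_L a a (V * Real.exp (-σ * t1)) t1 t2 u q ha.ne' h1 h12 hqi hF (by
    intro s k1 k2
    refine (hq s (h1.trans k1) (k2.trans h2T)).trans ?_
    rw [sub_self, zero_mul, Real.exp_zero, mul_one]
    gcongr ?_ * ?_
    apply Real.exp_le_exp.2; nlinarith)
  set F := Real.exp (-a * (t2 - t1)) with hFdef
  have hF1 : F ≤ 1 := Real.exp_le_one_iff.2 (by nlinarith)
  have hFε : Real.exp (-a * ε) ≤ F := Real.exp_le_exp.2 (by nlinarith)
  have hE : Real.exp (a * t1) = F * Real.exp (a * t2) := by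
    rw [hFdef, ← Real.exp_add]; ring_nf
  have hXp := Real.exp_pos (a * t2)
  rw [hE] at hL
  have hL2 : |u t2 - F * u t1| ≤ V * Real.exp (-σ * t1) * ((1 - F) / a) := by
    have e1 : Real.exp (a * t2) * u t2 - F * Real.exp (a * t2) * u t1 =
      Real.exp (a * t2) * (u t2 - F * u t1) := by ring
    have e2 : V * Real.exp (-σ * t1) * ((Real.exp (a * t2) - F * Real.exp (a * t2)) / a) =
      Real.exp (a * t2) * (V * Real.exp (-σ * t1) * ((1 - F) / a)) := by ring
    rw [e1, e2, abs_mul, Real.abs_exp] at hL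
    exact le_of_mul_le_mul_left hL hXp
  have hM : 0 ≤ M := (abs_nonneg _).trans h0
  have haσ : 0 < a - σ := by linarith
  have h3 : |u t2 - u t1| ≤ |u t2 - F * u t1| + (1 - F) * |u t1| := by
    have e : u t2 - u t1 = (u t2 - F * u t1) + (-(1 - F)) * u t1 := by ring
    calc |u t2 - u t1| ≤ |u t2 - F * u t1| + |(-(1 - F)) * u t1| := by
          conv_lhs => rw [e]
          exact abs_add_le _ _
      _ = _ := by rw [abs_mul, abs_neg, abs_of_nonneg (by linarith : 0 ≤ 1 - F)]
  calc |u t2 - u t1| ≤ V * Real.exp (-σ * t1) * ((1 - F) / a) +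
        (1 - F) * (Real.exp (-σ * t1) * (M + V / (a - σ))) := by
        have := mul_le_mul_of_nonneg_left hb (by linarith : 0 ≤ 1 - F)
        linarith
    _ = (1 - F) * (Real.exp (-σ * t1) * (M + V * (1 / (a - σ) + 1 / a))) := by ring
    _ ≤ (1 - Real.exp (-a * ε)) * (Real.exp (-σ * t1) * (M + V * (1 / (a - σ) + 1 / a))) := by
        gcongr
    _ = _ := by ring

set_option maxHeartbeats 1600000 in
lemma aux_core (a ε G M σ κ : ℝ) (ha : 0 < a) (hε : 0 < ε) (hε1 : ε < 1) (hG : 0 < G)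
    (hσ : 0 < σ) (hσa : σ < a) (hκ1 : κ < 1)
    (hκ : κ = G * (1 - Real.exp (-a * ε)) * Real.exp (2 * σ) * (1 / (a - σ) + 1 / a))
    (d u q : ℝ → ℝ) (hd1 : ∀ t, d t ∈ Set.Icc (-1 : ℝ) 1) (hu : Continuous u)
    (hqi : ∀ T, 0 ≤ T → IntervalIntegrable q volume 0 T)
    (hF : ∀ t, 0 ≤ t → Real.exp (a * t) * u t = u 0 + ∫ s in (0:ℝ)..t, Real.exp (a * s) * q s)
    (hq : ∀ s, |q s| ≤ G * |u (s - 1 - ε * d s) - u (s - 1)|)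
    (hM : ∀ s, -1 - ε ≤ s → s ≤ 0 → |u s| ≤ M) :
    ∀ s, -1 - ε ≤ s → |u s| ≤ Real.exp (-σ * s) *
      ((1 + 4 * G * Real.exp (16 * G) * Real.exp (2 * σ) / (1 - κ) / (a - σ)) * M) := by
  have hM0 : 0 ≤ M := (abs_nonneg _).trans (hM 0 (by linarith) le_rfl)
  have haσ : 0 < a - σ := by linarith
  have hκ' : 0 < 1 - κ := by linarith
  have h1 := aux_phase1 a ε G M ha hε hε1 hG d u q hd1 hu hqi hF hq hM
  have hEε : Real.exp (-a * ε) ≤ 1 := Real.exp_le_one_iff.2 (by nlinarith)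
  set A := 4 * G * Real.exp (16 * G) * Real.exp (2 * σ) * M with hA
  have hA0 : 0 ≤ A := by positivity
  have hκ0 : 0 ≤ κ := by
    rw [hκ]
    have : 0 ≤ 1 - Real.exp (-a * ε) := by linarith
    positivity
  -- one step
  have step : ∀ T V, 0 ≤ V → (∀ s, 0 ≤ s → s ≤ T → |q s| ≤ V * Real.exp (-σ * s)) →
      ∀ s, 0 ≤ s → s ≤ T → |q s| ≤ (A + κ * V) * Real.exp (-σ * s) := by
    intro T V hV hqV s hs hsT
    obtain ⟨g1, g2⟩ := hd1 s
    rcases le_or_gt s 2 with h | h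
    · have k1 := h1 (s - 1 - ε * d s) (by nlinarith) (by nlinarith)
      have k2 := h1 (s - 1) (by nlinarith) (by nlinarith)
      have k3 : 1 ≤ Real.exp (2 * σ) * Real.exp (-σ * s) := by
        rw [← Real.exp_add]; exact Real.one_le_exp (by nlinarith)
      calc |q s| ≤ G * |u (s - 1 - ε * d s) - u (s - 1)| := hq s
        _ ≤ G * (|u (s - 1 - ε * d s)| + |u (s - 1)|) := by gcongr; exact abs_sub _ _
        _ ≤ G * (2 * Real.exp (16 * G) * M + 2 * Real.exp (16 * G) * M) := by gcongr
        _ = (4 * G * Real.exp (16 * G) * M) * 1 := by ring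
        _ ≤ (4 * G * Real.exp (16 * G) * M) * (Real.exp (2 * σ) * Real.exp (-σ * s)) := by gcongr
        _ = A * Real.exp (-σ * s) := by rw [hA]; ring
        _ ≤ _ := by gcongr; nlinarith
    · have hdiff : |u (s - 1 - ε * d s) - u (s - 1)| ≤
          (1 - Real.exp (-a * ε)) * (Real.exp (2 * σ) * Real.exp (-σ * s)) *
            (M + V * (1 / (a - σ) + 1 / a)) := by
        have hexp : ∀ t1, s - 2 ≤ t1 →
            Real.exp (-σ * t1) ≤ Real.exp (2 * σ) * Real.exp (-σ * s) := by
          intro t1 ht1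
          rw [← Real.exp_add]; apply Real.exp_le_exp.2; nlinarith
        have h0 := hM 0 (by linarith) le_rfl
        have hpos : 0 ≤ 1 - Real.exp (-a * ε) := by linarith
        have hpos2 : 0 ≤ M + V * (1 / (a - σ) + 1 / a) := by positivity
        rcases le_total (s - 1 - ε * d s) (s - 1) with hc | hc
        · rw [abs_sub_comm]
          refine (aux_diff a ε σ V M T _ _ ha hσ hσa u q hV hqi hF hqV h0
            (by nlinarith) hc (by nlinarith) (by nlinarith)).trans ?_
          gcongr
          exact hexp _ (by nlinarith)
        · refine (aux_diff a ε σ V M T _ _ ha hσ hσa u q hV hqi hF hqV h0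
            (by nlinarith) hc (by nlinarith) (by nlinarith)).trans ?_
          gcongr
          exact hexp _ (by nlinarith)
      have hE16 : 1 ≤ Real.exp (16 * G) := Real.one_le_exp (by positivity)
      have hsm : G * (1 - Real.exp (-a * ε)) * Real.exp (2 * σ) * M ≤ A := by
        have e1 : G * (1 - Real.exp (-a * ε)) ≤ 4 * G * Real.exp (16 * G) := by
          have := Real.exp_pos (-a * ε)
          nlinarith
        rw [hA]; gcongr
      calc |q s| ≤ G * |u (s - 1 - ε * d s) - u (s - 1)| := hq s
        _ ≤ G * ((1 - Real.exp (-a * ε)) * (Real.exp (2 * σ) * Real.exp (-σ * s)) *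
            (M + V * (1 / (a - σ) + 1 / a))) := by gcongr
        _ = (G * (1 - Real.exp (-a * ε)) * Real.exp (2 * σ) * M + κ * V) * Real.exp (-σ * s) := by
            rw [hκ]; ring
        _ ≤ _ := by gcongr
  -- bound on q
  have hqb : ∀ T, 0 ≤ T → ∀ s, 0 ≤ s → s ≤ T → |q s| ≤ A / (1 - κ) * Real.exp (-σ * s) := by
    intro T hT
    obtain ⟨C, hC⟩ := (isCompact_Icc (a := -1 - ε) (b := T)).exists_bound_of_continuousOn
      hu.continuousOn
    have hbdd : BddAbove ((fun s => |q s| * Real.exp (σ * s)) '' Set.Icc 0 T) := by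
      refine ⟨G * (C + C) * Real.exp (σ * T), ?_⟩
      rintro _ ⟨s, hs, rfl⟩
      obtain ⟨g1, g2⟩ := hd1 s
      have hs1 := hs.1
      have hs2 := hs.2
      have k1 := hC (s - 1 - ε * d s) ⟨by nlinarith, by nlinarith⟩
      have k2 := hC (s - 1) ⟨by nlinarith, by nlinarith⟩
      rw [Real.norm_eq_abs] at k1 k2
      have hC0 : 0 ≤ C := (abs_nonneg _).trans k1
      have : |q s| ≤ G * (C + C) := (hq s).trans (by
        gcongr
        exact (abs_sub _ _).trans (by linarith))
      simp only
      gcongr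
    set S := sSup ((fun s => |q s| * Real.exp (σ * s)) '' Set.Icc 0 T) with hS
    have hle : ∀ s, 0 ≤ s → s ≤ T → |q s| * Real.exp (σ * s) ≤ S := fun s a1 a2 =>
      le_csSup hbdd ⟨s, ⟨a1, a2⟩, rfl⟩
    have hS0 : 0 ≤ S := le_trans (by positivity) (hle 0 le_rfl hT)
    have hconv : ∀ s, Real.exp (-σ * s) * Real.exp (σ * s) = 1 := by
      intro s; rw [← Real.exp_add]; ring_nf; simp
    have hle' : ∀ s, 0 ≤ s → s ≤ T → |q s| ≤ S * Real.exp (-σ * s) := by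
      intro s a1 a2
      calc |q s| = (|q s| * Real.exp (σ * s)) * Real.exp (-σ * s) := by
            rw [mul_assoc, mul_comm (Real.exp (σ * s)), hconv, mul_one]
        _ ≤ _ := by gcongr; exact hle s a1 a2
    have hS1 : S ≤ A + κ * S := by
      apply csSup_le ((Set.nonempty_Icc.2 hT).image _)
      rintro _ ⟨s, hs, rfl⟩
      have := step T S hS0 hle' s hs.1 hs.2
      calc |q s| * Real.exp (σ * s) ≤ ((A + κ * S) * Real.exp (-σ * s)) * Real.exp (σ * s) := by
            gcongr
        _ = _ := by rw [mul_assoc, hconv, mul_one]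
    have hS2 : S ≤ A / (1 - κ) := by rw [le_div_iff₀ hκ']; linarith
    intro s a1 a2
    exact (hle' s a1 a2).trans (by gcongr)
  intro s hs
  have hc : 0 ≤ A / (1 - κ) / (a - σ) := by positivity
  have e : (1 + 4 * G * Real.exp (16 * G) * Real.exp (2 * σ) / (1 - κ) / (a - σ)) * M =
      M + A / (1 - κ) / (a - σ) := by rw [hA]; ring
  rw [e]
  rcases le_total s 0 with h | h
  · have : 1 ≤ Real.exp (-σ * s) := Real.one_le_exp (by nlinarith)
    have := hM s hs h
    nlinarith
  · exact aux_bound a σ (A / (1 - κ)) M s s ha hσ hσa u q (by positivity) hqi hF (hqb s h)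
      (hM 0 (by linarith) le_rfl) h le_rfl

lemma aux_params (p ε : ℝ) (hp : 1 < p) (hε : 0 < ε)
    (hεbound : ε < 1 / (p - 1) *
      Real.log (2 * p * Real.exp 1 / (2 * p * Real.exp 1 - p + 1))) :
    ε < 1 ∧ ∃ σ, 0 < σ ∧ σ < p - 1 ∧
      p * Real.exp 1 * (1 - Real.exp (-(p - 1) * ε)) * Real.exp (2 * σ) *
        (1 / (p - 1 - σ) + 1 / (p - 1)) < 1 := by
  have ha : 0 < p - 1 := by linarith
  have he : 1 < Real.exp 1 := Real.one_lt_exp_iff.2 one_pos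
  have hden : 1 < 2 * p * Real.exp 1 - p + 1 := by nlinarith
  have h1 : (p - 1) * ε < Real.log (2 * p * Real.exp 1 / (2 * p * Real.exp 1 - p + 1)) := by
    rw [one_div, inv_mul_eq_div, lt_div_iff₀ ha] at hεbound
    linarith
  rw [Real.lt_log_iff_exp_lt (by positivity), lt_div_iff₀ (by linarith)] at h1
  have h2 := Real.add_one_le_exp ((p - 1) * ε)
  refine ⟨?_, ?_⟩
  · have h3 : ((p - 1) * ε + 1) * (2 * p * Real.exp 1 - p + 1) < 2 * p * Real.exp 1 := by
      nlinarith
    have h4 : (p - 1) * (ε * (2 * p * Real.exp 1 - p + 1)) < (p - 1) * 1 := by linarith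
    have h5 := lt_of_mul_lt_mul_left h4 ha.le
    nlinarith
  · have h6 : p * Real.exp 1 * (1 - Real.exp (-(p - 1) * ε)) * Real.exp (2 * 0) *
        (1 / (p - 1 - 0) + 1 / (p - 1)) < 1 := by
      have hinv : Real.exp (-(p - 1) * ε) * Real.exp ((p - 1) * ε) = 1 := by
        rw [← Real.exp_add]; ring_nf; simp
      have hpos := Real.exp_pos (-(p - 1) * ε)
      have h7 : 2 * p * Real.exp 1 - p + 1 < 2 * p * Real.exp 1 * Real.exp (-(p - 1) * ε) := by
        have := mul_lt_mul_of_pos_right h1 hpos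
        rw [mul_assoc, mul_comm (2 * p * Real.exp 1 - p + 1), ← mul_assoc,
          mul_comm (Real.exp ((p - 1) * ε)), hinv, one_mul] at this
        exact this
      have e : p * Real.exp 1 * (1 - Real.exp (-(p - 1) * ε)) * Real.exp (2 * 0) *
        (1 / (p - 1 - 0) + 1 / (p - 1)) =
          2 * (p * Real.exp 1 * (1 - Real.exp (-(p - 1) * ε))) / (p - 1) := by
        simp; ring
      rw [e, div_lt_one ha]
      linarith
    have hcont : ContinuousAt (fun σ : ℝ =>
        p * Real.exp 1 * (1 - Real.exp (-(p - 1) * ε)) * Real.exp (2 * σ) *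
        (1 / (p - 1 - σ) + 1 / (p - 1))) 0 := by
      have : p - 1 - 0 ≠ 0 := by linarith
      fun_prop (disch := assumption)
    have hev := hcont.eventually_lt_const h6
    have hev2 : ∀ᶠ σ : ℝ in nhds 0, σ < p - 1 := eventually_lt_nhds ha
    have hev3 := ((hev.and hev2).filter_mono
      (nhdsWithin_le_nhds (s := Set.Ioi (0:ℝ)))).and self_mem_nhdsWithin
    obtain ⟨σ, ⟨hs1, hs2⟩, hs3⟩ := hev3.exists
    exact ⟨σ, hs3, hs2, hs1⟩

theorem stmt_19 (p ε : ℝ) (hp : 1 < p)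
    (hε : 0 < ε)
    (hεbound : ε < 1 / (p - 1) *
      Real.log (2 * p * Real.exp 1 / (2 * p * Real.exp 1 - p + 1))) :
    ∃ Q σ : ℝ, 0 < Q ∧ 0 < σ ∧
      ∀ (d : ℝ → ℝ), Measurable d → (∀ t, 0 ≤ t → d t ∈ Set.Icc (-1 : ℝ) 1) →
        ∀ (x u : ℝ → ℝ),
          ContinuousOn x (Set.Ici 0) →
          ContinuousOn u (Set.Ici (-(1 + ε))) →
          -- the plant dynamics
          (∀ t : ℝ, 0 ≤ t →
            x t = x 0 + ∫ s in (0 : ℝ)..t, (x s + u (s - 1 - ε * d s))) →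
          -- the predictor feedback
          (∀ t : ℝ, 0 ≤ t →
            u t = -p * Real.exp 1 * x t -
              p * ∫ s in (0 : ℝ)..1, Real.exp s * u (t - s)) →
          ∀ t : ℝ, 0 ≤ t →
            |x t| + sSup ((fun s => |u s|) '' Set.Icc (t - 1 - ε) t) ≤
              Q * Real.exp (-σ * t) *
                (|x 0| + sSup ((fun s => |u s|) '' Set.Icc (-1 - ε) 0)) := by
  obtain ⟨hε1, σ, hσ, hσa, hκ1⟩ := aux_params p ε hp hε hεbound
  have ha : 0 < p - 1 := by linarith
  have he : 1 < Real.exp 1 := Real.one_lt_exp_iff.2 one_pos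
  set G := p * Real.exp 1 with hGdef
  have hG : 1 < G := by nlinarith
  set κ := G * (1 - Real.exp (-(p - 1) * ε)) * Real.exp (2 * σ) *
        (1 / (p - 1 - σ) + 1 / (p - 1)) with hκ
  set c := 1 + 4 * G * Real.exp (16 * G) * Real.exp (2 * σ) / (1 - κ) / (p - 1 - σ) with hc
  have hc0 : 0 < c := by
    have h1 : 0 < 1 - κ := by linarith
    have h2 : 0 < p - 1 - σ := by linarith
    have h3 : 0 < G := by linarith
    positivity
  refine ⟨3 * Real.exp (2 * σ) * c, σ, by positivity, hσ, ?_⟩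
  intro d hd hd1 x u hx hu hX hU
  set M := |x 0| + sSup ((fun s => |u s|) '' Set.Icc (-1 - ε) 0) with hM
  have hbdd : BddAbove ((fun s => |u s|) '' Set.Icc (-1 - ε) 0) := by
    apply IsCompact.bddAbove_image isCompact_Icc
    apply ContinuousOn.abs
    apply hu.mono
    intro s hs
    simp only [Set.mem_Ici]
    linarith [hs.1]
  have hMu : ∀ s, -1 - ε ≤ s → s ≤ 0 → |u s| ≤ M := by
    intro s h1 h2
    have h3 : |u s| ≤ sSup ((fun s => |u s|) '' Set.Icc (-1 - ε) 0) :=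
      le_csSup hbdd ⟨s, ⟨h1, h2⟩, rfl⟩
    linarith [abs_nonneg (x 0)]
  -- global extensions
  obtain ⟨x', hx', hxe⟩ : ∃ x' : ℝ → ℝ, Continuous x' ∧ ∀ t, 0 ≤ t → x' t = x t :=
    ⟨fun t => x (max t 0), hx.comp_continuous (by fun_prop) (fun t => by simp),
      fun t ht => by simp [ht]⟩
  obtain ⟨u', hu', hue⟩ : ∃ u' : ℝ → ℝ, Continuous u' ∧ ∀ t, -1 - ε ≤ t → u' t = u t :=
    ⟨fun t => u (max t (-(1 + ε))), hu.comp_continuous (by fun_prop) (fun t => by simp),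
      fun t ht => by
        simp only
        rw [max_eq_left (by linarith)]⟩
  obtain ⟨d', hd', hd1', hde⟩ : ∃ d' : ℝ → ℝ, Measurable d' ∧
      (∀ t, d' t ∈ Set.Icc (-1 : ℝ) 1) ∧ ∀ t, 0 ≤ t → d' t = d t :=
    ⟨fun t => max (-1) (min 1 (d t)), by fun_prop, fun t => by
        constructor
        · exact le_max_left _ _
        · exact max_le (by norm_num) (min_le_left _ _),
      fun t ht => by
        obtain ⟨g1, g2⟩ := hd1 t ht
        simp only
        rw [min_eq_right g2, max_eq_right g1]⟩
  have hX' : ∀ t : ℝ, 0 ≤ t →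
      x' t = x' 0 + ∫ s in (0 : ℝ)..t, (x' s + u' (s - 1 - ε * d' s)) := by
    intro t ht
    rw [hxe t ht, hxe 0 le_rfl, hX t ht]
    congr 1
    apply intervalIntegral.integral_congr
    intro s hs
    rw [Set.uIcc_of_le ht] at hs
    obtain ⟨g1, g2⟩ := hd1 s hs.1
    simp only
    rw [hxe s hs.1, hde s hs.1, hue _ (by nlinarith [hs.1])]
  have hU' : ∀ t : ℝ, 0 ≤ t →
      u' t = -p * Real.exp 1 * x' t -
        p * ∫ s in (0 : ℝ)..1, Real.exp s * u' (t - s) := by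
    intro t ht
    rw [hxe t ht, hue t (by linarith), hU t ht]
    congr 2
    apply intervalIntegral.integral_congr
    intro s hs
    rw [Set.uIcc_of_le zero_le_one] at hs
    simp only
    rw [hue _ (by linarith [hs.2])]
  have hF := aux_formula p ε hε d' x' u' hd' hd1' hx' hu' hX' hU'
  have core := aux_core (p - 1) ε G M σ κ ha hε hε1 (by linarith) hσ hσa hκ1 hκ d' u'
    (fun s => -p * Real.exp 1 * (u' (s - 1 - ε * d' s) - u' (s - 1))) hd1' hu'
    (fun T hT => ((aux_int ε T hε hT d' u' hd' hd1' hu').sub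
      (Continuous.intervalIntegrable (by fun_prop) _ _)).const_mul _)
    hF
    (fun s => by
      rw [abs_mul, show -p * Real.exp 1 = -G by rw [hGdef]; ring, abs_neg,
        abs_of_pos (by linarith : 0 < G)])
    (fun s h1 h2 => by rw [hue s h1]; exact hMu s h1 h2)
  have hM0 : 0 ≤ M := (abs_nonneg _).trans (hMu 0 (by linarith) le_rfl)
  intro t ht
  set R := Real.exp (2 * σ) * Real.exp (-σ * t) * (c * M) with hR
  have hR0 : 0 ≤ R := by positivity
  have hwin : ∀ s, t - 1 - ε ≤ s → |u s| ≤ R := by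
    intro s h1
    have h3 := core s (by linarith)
    rw [hue s (by linarith)] at h3
    refine h3.trans ?_
    rw [hR, ← Real.exp_add]
    have : Real.exp (-σ * s) ≤ Real.exp (2 * σ + -σ * t) := Real.exp_le_exp.2 (by nlinarith)
    gcongr
  have hsup : sSup ((fun s => |u s|) '' Set.Icc (t - 1 - ε) t) ≤ R := by
    apply csSup_le ((Set.nonempty_Icc.2 (by linarith)).image _)
    rintro _ ⟨s, hs, rfl⟩
    exact hwin s hs.1
  have hint : |∫ s in (0 : ℝ)..1, Real.exp s * u (t - s)| ≤ Real.exp 1 * R := by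
    have := intervalIntegral.norm_integral_le_of_norm_le_const (a := 0) (b := 1)
      (f := fun s => Real.exp s * u (t - s)) (C := Real.exp 1 * R) (by
        intro s hs
        rw [Set.uIoc_of_le zero_le_one] at hs
        rw [norm_mul, Real.norm_eq_abs, Real.norm_eq_abs, Real.abs_exp]
        have h1 := hwin (t - s) (by linarith [hs.2])
        have h2 : Real.exp s ≤ Real.exp 1 := Real.exp_le_exp.2 hs.2
        gcongr)
    simpa using this
  have hxb : |x t| ≤ 2 * R := by
    have h1 : G * x t = -u t - p * ∫ s in (0 : ℝ)..1, Real.exp s * u (t - s) := by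
      have := hU t ht
      rw [hGdef]; linarith
    have h2 : G * |x t| ≤ R + G * R := by
      calc G * |x t| = |G * x t| := by rw [abs_mul, abs_of_pos (by linarith : 0 < G)]
        _ ≤ |-u t| + |p * ∫ s in (0 : ℝ)..1, Real.exp s * u (t - s)| := by
            rw [h1]; exact abs_sub _ _
        _ = |u t| + p * |∫ s in (0 : ℝ)..1, Real.exp s * u (t - s)| := by
            rw [abs_neg, abs_mul, abs_of_pos (by linarith : 0 < p)]
        _ ≤ R + p * (Real.exp 1 * R) := by
            gcongr
            exact hwin t (by linarith)
        _ = _ := by rw [hGdef]; ring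
    have h3 : G * |x t| ≤ G * (2 * R) := by nlinarith
    exact le_of_mul_le_mul_left h3 (by linarith)
  calc _ ≤ 2 * R + R := add_le_add hxb hsup
    _ = _ := by rw [hR]; ring
end
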